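/- arXiv:2306.07811 — 2 statements merged into one kernel-verified Lean document; each statement's English description precedes it below -/
import Mathlib

section
/- For every normalized finite Rademacher sum X = Σ_{i=1}^n a_i ε_i, one has P(|X| ≥ 1/√7) ≥ 1/2. -/
/-- The probability that a finite Rademacher sum with weights `a` (signs chosen
independently and uniformly from `{-1,+1}`) satisfies the predicate `p`. -/
noncomputable def radProb {ι : Type*} [Fintype ι] (a : ι → ℝ) (p : ℝ → Prop) : ℝ :=
  (Nat.card {ε : ι → Bool | p (∑ i, a i * (if ε i then (1 : ℝ) else -1))}) /
    2 ^ (Fintype.card ι)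

open Real

/-- The probability that `|t + ∑ aᵢ εᵢ| < x`, where the `aᵢ` run through a list. -/
noncomputable def smallBall : List ℝ → ℝ → ℝ → ℝ
  | [], t, x => if |t| < x then 1 else 0
  | a :: l, t, x => (smallBall l (t + a) x + smallBall l (t - a) x) / 2

/-- The sum of the squares of the entries of a list. -/
def sumSq (l : List ℝ) : ℝ := (l.map (· ^ 2)).sum

@[simp] lemma sumSq_nil : sumSq [] = 0 := rfl

@[simp] lemma sumSq_cons (a : ℝ) (l : List ℝ) : sumSq (a :: l) = a ^ 2 + sumSq l := by
  simp [sumSq]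

@[simp] lemma sumSq_append (l l' : List ℝ) : sumSq (l ++ l') = sumSq l + sumSq l' := by
  simp [sumSq]

lemma sumSq_perm {l l' : List ℝ} (h : l.Perm l') : sumSq l = sumSq l' :=
  (h.map _).sum_eq

lemma sumSq_nonneg (l : List ℝ) : 0 ≤ sumSq l := by
  induction l with
  | nil => simp
  | cons a l ih => rw [sumSq_cons]; positivity

lemma sumSq_le_length {l : List ℝ} (h : ∀ a ∈ l, 0 ≤ a ∧ a ≤ 1) : sumSq l ≤ l.length := by
  induction l with
  | nil => simp
  | cons a l ih =>
    have h1 := h a (by simp)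
    have h2 := ih fun b hb => h b (by simp [hb])
    rw [sumSq_cons, List.length_cons]
    push_cast
    nlinarith

lemma smallBall_le_one (l : List ℝ) (t x : ℝ) : smallBall l t x ≤ 1 := by
  induction l generalizing t with
  | nil => unfold smallBall; split_ifs <;> simp
  | cons a l ih => unfold smallBall; linarith [ih (t + a), ih (t - a)]

lemma smallBall_of_nonpos (l : List ℝ) (t : ℝ) {x : ℝ} (hx : x ≤ 0) : smallBall l t x = 0 := by
  induction l generalizing t with
  | nil => unfold smallBall; rw [if_neg]; linarith [abs_nonneg t]
  | cons a l ih => unfold smallBall; simp [ih]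

lemma smallBall_perm {l l' : List ℝ} (h : l.Perm l') (t x : ℝ) :
    smallBall l t x = smallBall l' t x := by
  induction h generalizing t with
  | nil => rfl
  | cons a _ ih => simp only [smallBall, ih]
  | swap a b l =>
    simp only [smallBall]
    rw [show t + b - a = t - a + b by ring, show t + a + b = t + b + a by ring,
      show t + a - b = t - b + a by ring, show t - b - a = t - a - b by ring]
    ring
  | trans _ _ ih₁ ih₂ => rw [ih₁, ih₂]

lemma smallBall_map_abs (l : List ℝ) (t x : ℝ) :
    smallBall (l.map fun a => |a|) t x = smallBall l t x := by
  induction l generalizing t with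
  | nil => rfl
  | cons a l ih =>
    simp only [List.map_cons, smallBall, ih]
    rcases abs_cases a with ⟨h, _⟩ | ⟨h, _⟩ <;> rw [h]
    rw [sub_neg_eq_add, ← sub_eq_add_neg, add_comm]

lemma smallBall_shift (l : List ℝ) (t x : ℝ) {a : ℝ} (ha : 0 ≤ a) :
    smallBall l (t + a) x + smallBall l (t - a) x ≤
      smallBall l t (x + a) + smallBall l t (x - a) := by
  induction l generalizing t with
  | nil =>
    unfold smallBall
    split_ifs <;> try norm_num
    all_goals exfalso; simp only [abs_lt, not_and_or, not_lt] at *; grind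
  | cons b l ih =>
    unfold smallBall
    have h1 := ih (t + b)
    have h2 := ih (t - b)
    rw [show t + a + b = t + b + a by ring, show t + a - b = t - b + a by ring,
      show t - a + b = t + b - a by ring, show t - a - b = t - b - a by ring]
    linarith

/-- One step of a walk killed at the origin dominates the concentration of the sum. -/
lemma smallBall_cons_le (l : List ℝ) (x : ℝ) {a : ℝ} (ha : 0 ≤ a) :
    smallBall (a :: l) 0 x ≤ (smallBall l 0 (x - a) + smallBall l 0 (x + a)) / 2 := by
  have := smallBall_shift l 0 x ha
  rw [smallBall]
  linarith

/-- The sum of the `j` largest binomial coefficients `m.choose i`, computed as the number of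
paths of length `m` started at height `j` that stay positive. -/
def positivePaths : ℕ → ℕ → ℕ
  | _, 0 => 0
  | 0, _ + 1 => 1
  | m + 1, j + 1 => positivePaths m j + positivePaths m (j + 2)

/-- The Erdős–Littlewood–Offord inequality. -/
lemma smallBall_le_positivePaths (b l : List ℝ) (j : ℕ) {c x : ℝ} (hc : 0 ≤ c)
    (hb : (c :: b).Pairwise (· ≤ ·)) (hx : x ≤ j * c) :
    smallBall (b ++ l) 0 x ≤ positivePaths b.length j / 2 ^ b.length := by
  induction b generalizing c x j with
  | nil =>
    cases j with
    | zero => rw [smallBall_of_nonpos _ _ (by simpa using hx)]; simp [positivePaths]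
    | succ j => simpa [positivePaths] using smallBall_le_one l 0 x
  | cons a b ih =>
    have hca : c ≤ a := (List.pairwise_cons.1 hb).1 a (by simp)
    have hb' := (List.pairwise_cons.1 hb).2
    cases j with
    | zero => rw [smallBall_of_nonpos _ _ (by simpa using hx)]; simp [positivePaths]
    | succ j =>
      push_cast at hx
      have hja : (j : ℝ) * c ≤ j * a := by gcongr
      have h1 := ih j (x := x - a) (hc.trans hca) hb' (by linarith)
      have h2 := ih (j + 2) (x := x + a) (hc.trans hca) hb' (by push_cast; linarith)
      have h3 := smallBall_cons_le (b ++ l) x (hc.trans hca)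
      rw [List.cons_append, List.length_cons, positivePaths, pow_succ]
      push_cast
      calc _ ≤ _ := h3
        _ ≤ (positivePaths b.length j / 2 ^ b.length +
            positivePaths b.length (j + 2) / 2 ^ b.length) / 2 := by linarith
        _ = _ := by field_simp

lemma smallBall_ofFn (n : ℕ) (a : Fin n → ℝ) (t x : ℝ) :
    smallBall (List.ofFn a) t x =
      (∑ ε : Fin n → Bool,
        if |t + ∑ i, a i * (if ε i then (1 : ℝ) else -1)| < x then (1 : ℝ) else 0) / 2 ^ n := by
  induction n generalizing t with
  | zero => simp [smallBall]
  | succ n ih =>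
    rw [List.ofFn_succ, smallBall, ih, ih, ← (Fin.consEquiv fun _ => Bool).sum_comp,
      Fintype.sum_prod_type, Fintype.sum_bool]
    simp only [Fin.consEquiv_apply, Fin.sum_univ_succ, Fin.cons_zero, Fin.cons_succ, if_true,
      Bool.false_eq_true, if_false, mul_one, mul_neg, ← add_assoc, ← sub_eq_add_neg]
    rw [pow_succ]
    field_simp

section
open intervalIntegral

/-- The unnormalised Gaussian distribution function centred at the origin. -/
noncomputable def gaussInt (z : ℝ) : ℝ := ∫ t in (0 : ℝ)..z, exp (-t ^ 2 / 2)

lemma hasDerivAt_gaussInt (z : ℝ) : HasDerivAt gaussInt (exp (-z ^ 2 / 2)) z := by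
  have hc : Continuous fun t : ℝ => exp (-t ^ 2 / 2) := by fun_prop
  exact integral_hasDerivAt_right (hc.intervalIntegrable _ _)
    (hc.stronglyMeasurableAtFilter _ _) hc.continuousAt

lemma gaussInt_zero : gaussInt 0 = 0 := by simp [gaussInt]

lemma continuous_gaussInt : Continuous gaussInt :=
  continuous_iff_continuousAt.2 fun z => (hasDerivAt_gaussInt z).continuousAt

lemma gaussInt_strictMono : StrictMono gaussInt :=
  strictMono_of_deriv_pos fun z => by rw [(hasDerivAt_gaussInt z).deriv]; positivity

lemma gaussInt_nonneg {z : ℝ} (hz : 0 ≤ z) : 0 ≤ gaussInt z := by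
  rw [← gaussInt_zero]; exact gaussInt_strictMono.monotone hz

lemma gaussInt_concaveOn : ConcaveOn ℝ (Set.Ici 0) gaussInt := by
  refine AntitoneOn.concaveOn_of_deriv (convex_Ici 0) continuous_gaussInt.continuousOn
    (fun z _ => (hasDerivAt_gaussInt z).differentiableAt.differentiableWithinAt) ?_
  intro x hx y hy hxy
  rw [interior_Ici, Set.mem_Ioi] at hx hy
  rw [(hasDerivAt_gaussInt x).deriv, (hasDerivAt_gaussInt y).deriv]
  apply exp_le_exp.2
  nlinarith

lemma gaussInt_add_le {x y z : ℝ} (hx : 0 ≤ x) (hy : 0 ≤ y) (h : x + y ≤ 2 * z) :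
    gaussInt x + gaussInt y ≤ 2 * gaussInt z := by
  have h1 := gaussInt_concaveOn.2 hx hy (by norm_num : (0 : ℝ) ≤ 1 / 2)
    (by norm_num : (0 : ℝ) ≤ 1 / 2) (by norm_num)
  simp only [smul_eq_mul] at h1
  have h2 : gaussInt (1 / 2 * x + 1 / 2 * y) ≤ gaussInt z :=
    gaussInt_strictMono.monotone (by linarith)
  linarith

lemma log_sub_log_le {r : ℝ} (h0 : 0 ≤ r) (h1 : r < 1) :
    log (1 + r) - log (1 - r) ≤ 2 * r + 2 / 3 * (r ^ 3 / (1 - r ^ 2)) := by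
  set f : ℝ → ℝ := fun x => 2 * x + 2 / 3 * (x ^ 3 / (1 - x ^ 2)) - (log (1 + x) - log (1 - x))
  have hd : ∀ x ∈ Set.Ico (0 : ℝ) 1, HasDerivAt f (4 / 3 * x ^ 4 / (1 - x ^ 2) ^ 2) x := by
    intro x hx
    have h2 : 1 - x ^ 2 ≠ 0 := by nlinarith [hx.1, hx.2]
    have h3 : 1 + x ≠ 0 := by linarith [hx.1]
    have h4 : 1 - x ≠ 0 := by linarith [hx.2]
    have := (((hasDerivAt_id x).const_mul 2).add ((((hasDerivAt_id x).pow 3).div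
      (((hasDerivAt_id x).pow 2).const_sub 1) h2).const_mul (2 / 3))).sub
      ((((hasDerivAt_id x).const_add 1).log h3).sub (((hasDerivAt_id x).const_sub 1).log h4))
    refine this.congr_deriv ?_
    simp only [id_eq, Pi.pow_apply, Nat.cast_ofNat, Nat.add_one_sub_one, pow_one, mul_one]
    have h5 : 1 - x ^ 2 = (1 - x) * (1 + x) := by ring
    rw [h5]
    field_simp
    ring
  have hm : MonotoneOn f (Set.Icc 0 r) := by
    refine monotoneOn_of_deriv_nonneg (convex_Icc 0 r)
      (fun x hx => (hd x ⟨hx.1, hx.2.trans_lt h1⟩).continuousAt.continuousWithinAt) ?_ ?_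
    · intro x hx
      rw [interior_Icc] at hx
      exact (hd x ⟨hx.1.le, hx.2.trans h1⟩).differentiableAt.differentiableWithinAt
    · intro x hx
      rw [interior_Icc] at hx
      rw [(hd x ⟨hx.1.le, hx.2.trans h1⟩).deriv]
      positivity
  have := hm (Set.left_mem_Icc.2 h0) (Set.right_mem_Icc.2 h0) h0
  simp only [f] at this
  norm_num at this
  linarith

lemma gaussInt_step {w y a : ℝ} (ha : 0 ≤ a) (haw : a ^ 2 < w) (hy : 0 ≤ y)
    (h : y ^ 2 * (w + 2 * a ^ 2) ≤ 3 * w ^ 2) :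
    gaussInt ((y + a) / √(w - a ^ 2)) + gaussInt ((y - a) / √(w - a ^ 2)) ≤
      2 * gaussInt (y / √w) := by
  have hw : 0 < w := by nlinarith
  set f : ℝ → ℝ := fun x =>
    gaussInt ((y + x) / √(w - x ^ 2)) + gaussInt ((y - x) / √(w - x ^ 2))
  have hd : ∀ x ∈ Set.Icc 0 a, HasDerivAt f
      ((exp (-((y + x) / √(w - x ^ 2)) ^ 2 / 2) * (w + x * y) -
        exp (-((y - x) / √(w - x ^ 2)) ^ 2 / 2) * (w - x * y)) /
          (√(w - x ^ 2) * (w - x ^ 2))) x := by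
    intro x hx
    have hx2 : 0 < w - x ^ 2 := by nlinarith [hx.1, hx.2]
    have hs : √(w - x ^ 2) ≠ 0 := (sqrt_pos.2 hx2).ne'
    have hsq := sq_sqrt hx2.le
    have h1 := (((hasDerivAt_id x).pow 2).const_sub w).sqrt hx2.ne'
    have h2 := (hasDerivAt_gaussInt _).comp x (((hasDerivAt_id x).const_add y).div h1 hs)
    have h3 := (hasDerivAt_gaussInt _).comp x (((hasDerivAt_id x).const_sub y).div h1 hs)
    refine (h2.add h3).congr_deriv ?_
    simp only [id_eq, Pi.pow_apply, Pi.div_apply, hsq, Nat.cast_ofNat, Nat.add_one_sub_one,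
      pow_one, mul_one]
    have hx3 := hx2.ne'
    field_simp
    rw [hsq]
    ring
  have hm : AntitoneOn f (Set.Icc 0 a) := by
    refine antitoneOn_of_deriv_nonpos (convex_Icc 0 a)
      (fun x hx => (hd x hx).continuousAt.continuousWithinAt) ?_ ?_
    · intro x hx
      exact (hd x (interior_subset hx)).differentiableAt.differentiableWithinAt
    · intro x hx
      rw [(hd x (interior_subset hx)).deriv]
      rw [interior_Icc] at hx
      have hxa : x ^ 2 < a ^ 2 := by nlinarith [hx.1, hx.2]
      have hx2 : 0 < w - x ^ 2 := by linarith
      apply div_nonpos_of_nonpos_of_nonneg _ (by positivity)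
      have hcond : y ^ 2 * (w + 2 * x ^ 2) ≤ 3 * w ^ 2 :=
        le_trans (by gcongr) h
      have hx0 : 0 < x ^ 2 := by nlinarith [hx.1]
      have hxy : x * y < w := by
        have : (x * y) ^ 2 < w ^ 2 := by
          have : x ^ 2 * (y ^ 2 * (w + 2 * x ^ 2)) ≤ x ^ 2 * (3 * w ^ 2) := by gcongr
          have h3 : x ^ 2 * (3 * w ^ 2) < w ^ 2 * (w + 2 * x ^ 2) := by nlinarith [mul_pos hw hw]
          have h4 : (x * y) ^ 2 * (w + 2 * x ^ 2) < w ^ 2 * (w + 2 * x ^ 2) := by nlinarith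
          exact lt_of_mul_lt_mul_right h4 (by positivity)
        exact lt_of_pow_lt_pow_left₀ 2 hw.le this
      have hr0 : 0 ≤ x * y / w := by have := hx.1; positivity
      have hr1 : x * y / w < 1 := (div_lt_one hw).2 hxy
      have hlog := log_sub_log_le hr0 hr1
      have hrr : 0 < w ^ 2 - (x * y) ^ 2 := by nlinarith [mul_nonneg hx.1.le hy]
      have hkey : 2 * (x * y / w) + 2 / 3 * ((x * y / w) ^ 3 / (1 - (x * y / w) ^ 2)) ≤
          2 * (x * y) / (w - x ^ 2) := by
        have e : 2 * (x * y / w) + 2 / 3 * ((x * y / w) ^ 3 / (1 - (x * y / w) ^ 2)) =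
            2 * (x * y / w) * (1 + (x * y) ^ 2 / (3 * (w ^ 2 - (x * y) ^ 2))) := by
          have : 1 - (x * y / w) ^ 2 = (w ^ 2 - (x * y) ^ 2) / w ^ 2 := by field_simp
          rw [this]
          have := hrr.ne'
          field_simp
        have e2 : 2 * (x * y) / (w - x ^ 2) = 2 * (x * y / w) * (1 + x ^ 2 / (w - x ^ 2)) := by
          have := hx2.ne'
          field_simp
          ring
        rw [e, e2]
        have : (x * y) ^ 2 / (3 * (w ^ 2 - (x * y) ^ 2)) ≤ x ^ 2 / (w - x ^ 2) := by
          rw [div_le_div_iff₀ (by positivity) hx2]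
          have := mul_le_mul_of_nonneg_left hcond hx0.le
          nlinarith
        gcongr
      rw [← log_div (by linarith) (by linarith)] at hlog
      have hexp := (log_le_iff_le_exp (div_pos (by linarith) (by linarith))).1
        (hlog.trans hkey)
      have hwxy : 0 < w - x * y := by linarith
      have hdiv : (1 + x * y / w) / (1 - x * y / w) = (w + x * y) / (w - x * y) := by
        have h5 : 1 - x * y / w = (w - x * y) / w := by field_simp
        have h6 : 1 + x * y / w = (w + x * y) / w := by field_simp
        rw [h5, h6]
        field_simp
      rw [hdiv, div_le_iff₀ hwxy] at hexp
      have hsplit : exp (-((y - x) / √(w - x ^ 2)) ^ 2 / 2) =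
          exp (-((y + x) / √(w - x ^ 2)) ^ 2 / 2) * exp (2 * (x * y) / (w - x ^ 2)) := by
        rw [← exp_add, div_pow, div_pow, sq_sqrt hx2.le]
        congr 1
        field_simp
        ring
      rw [hsplit]
      have := mul_le_mul_of_nonneg_left hexp (exp_pos (-((y + x) / √(w - x ^ 2)) ^ 2 / 2)).le
      linarith
  have := hm (Set.left_mem_Icc.2 ha) (Set.right_mem_Icc.2 ha) ha
  simp only [f] at this
  norm_num at this
  linarith

end

/-- A truncated Gaussian profile, used to bound the probability that a Rademacher sum of variance
at least `w` lies in `(-y, y)`. -/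
noncomputable def gaussBound (y w : ℝ) : ℝ := min 1 (gaussInt (y / √w) / gaussInt (17 / 10))

/-- Partial sums of the Taylor series of `gaussInt`. -/
noncomputable def gaussTaylor (N : ℕ) (z : ℝ) : ℝ :=
  ∑ k ∈ Finset.range N, (-1) ^ k * z ^ (2 * k + 1) / (2 ^ k * k.factorial * (2 * k + 1))

lemma exp_neg_alternating (N : ℕ) {u : ℝ} (hu : 0 ≤ u) :
    0 ≤ (-1) ^ N * (exp (-u) - ∑ k ∈ Finset.range N, (-u) ^ k / k.factorial) := by
  induction N generalizing u with
  | zero => simpa using (exp_pos _).le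
  | succ N ih =>
    set f : ℝ → ℝ := fun x =>
      (-1) ^ (N + 1) * (exp (-x) - ∑ k ∈ Finset.range (N + 1), (-x) ^ k / k.factorial)
    have hd : ∀ x, HasDerivAt f
        ((-1) ^ N * (exp (-x) - ∑ k ∈ Finset.range N, (-x) ^ k / k.factorial)) x := by
      intro x
      have h1 : HasDerivAt (fun x : ℝ => ∑ k ∈ Finset.range (N + 1), (-x) ^ k / k.factorial)
          (∑ k ∈ Finset.range (N + 1), (k * (-x) ^ (k - 1) * (-1)) / k.factorial) x := by
        refine HasDerivAt.fun_sum fun k _ => ?_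
        exact ((hasDerivAt_neg x).pow k).div_const _
      refine (((hasDerivAt_neg x).exp.sub h1).const_mul ((-1) ^ (N + 1))).congr_deriv ?_
      rw [Finset.sum_range_succ']
      have h2 : ∀ k ∈ Finset.range N, (((k + 1 : ℕ) : ℝ) * (-x) ^ (k + 1 - 1) * (-1)) /
          (k + 1).factorial = - ((-x) ^ k / k.factorial) := by
        intro k _
        rw [Nat.factorial_succ]
        push_cast
        have : (k : ℝ) + 1 ≠ 0 := by positivity
        have : (k.factorial : ℝ) ≠ 0 := by positivity
        field_simp
      rw [Finset.sum_congr rfl h2, Finset.sum_neg_distrib]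
      simp only [Nat.cast_zero, zero_mul, zero_div, add_zero]
      ring
    have hm : MonotoneOn f (Set.Ici 0) := by
      refine monotoneOn_of_deriv_nonneg (convex_Ici 0)
        (fun x _ => (hd x).continuousAt.continuousWithinAt)
        (fun x _ => (hd x).differentiableAt.differentiableWithinAt) ?_
      intro x hx
      rw [interior_Ici] at hx
      rw [(hd x).deriv]
      exact ih hx.le
    have h0 : f 0 = 0 := by simp [f, Finset.sum_range_succ']
    rw [← h0]
    exact hm (Set.mem_Ici.2 le_rfl) hu hu

lemma gaussInt_alternating (N : ℕ) {z : ℝ} (hz : 0 ≤ z) :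
    0 ≤ (-1) ^ N * (gaussInt z - gaussTaylor N z) := by
  set f : ℝ → ℝ := fun x => (-1) ^ N * (gaussInt x - gaussTaylor N x)
  have hd : ∀ x, HasDerivAt f
      ((-1) ^ N * (exp (-(x ^ 2 / 2)) -
        ∑ k ∈ Finset.range N, (-(x ^ 2 / 2)) ^ k / k.factorial)) x := by
    intro x
    have h1 : HasDerivAt (gaussTaylor N)
        (∑ k ∈ Finset.range N, (-(x ^ 2 / 2)) ^ k / k.factorial) x := by
      refine HasDerivAt.fun_sum fun k _ => ?_
      refine (((hasDerivAt_pow (2 * k + 1) x).const_mul ((-1) ^ k)).div_const _).congr_deriv ?_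
      have : (2 * (k : ℝ) + 1) ≠ 0 := by positivity
      have : (k.factorial : ℝ) ≠ 0 := by positivity
      rw [neg_pow (x ^ 2 / 2), div_pow, ← pow_mul]
      push_cast
      field_simp
    refine (((hasDerivAt_gaussInt x).sub h1).const_mul _).congr_deriv ?_
    rw [neg_div]
  have hm : MonotoneOn f (Set.Ici 0) := by
    refine monotoneOn_of_deriv_nonneg (convex_Ici 0)
      (fun x _ => (hd x).continuousAt.continuousWithinAt)
      (fun x _ => (hd x).differentiableAt.differentiableWithinAt) ?_
    intro x _
    rw [(hd x).deriv]
    exact exp_neg_alternating N (by positivity)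
  have h0 : f 0 = 0 := by simp [f, gaussInt_zero, gaussTaylor]
  rw [← h0]
  exact hm (Set.mem_Ici.2 le_rfl) hz hz

lemma le_gaussInt {z : ℝ} (hz : 0 ≤ z) (N : ℕ) (hN : Even N) : gaussTaylor N z ≤ gaussInt z := by
  have := gaussInt_alternating N hz
  rw [hN.neg_one_pow] at this
  linarith

lemma gaussInt_le {z : ℝ} (hz : 0 ≤ z) (N : ℕ) (hN : Odd N) : gaussInt z ≤ gaussTaylor N z := by
  have := gaussInt_alternating N hz
  rw [hN.neg_one_pow] at this
  linarith

lemma gaussInt_cutoff_le : gaussInt (17 / 10) ≤ 11418 / 10000 := by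
  refine (gaussInt_le (by norm_num) 9 (by decide)).trans ?_
  norm_num [gaussTaylor, Finset.sum_range_succ, Nat.factorial]

lemma le_gaussInt_cutoff : 11414 / 10000 ≤ gaussInt (17 / 10) := by
  refine le_trans ?_ (le_gaussInt (by norm_num) 8 (by decide))
  norm_num [gaussTaylor, Finset.sum_range_succ, Nat.factorial]

lemma gaussInt_cutoff_pos : 0 < gaussInt (17 / 10) :=
  lt_of_lt_of_le (by norm_num) le_gaussInt_cutoff

lemma gaussBound_le_one (y w : ℝ) : gaussBound y w ≤ 1 := min_le_left _ _

lemma gaussBound_le (y w : ℝ) : gaussBound y w ≤ gaussInt (y / √w) / gaussInt (17 / 10) :=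
  min_le_right _ _

lemma le_gaussBound {y w z c : ℝ} (hz : z ≤ y / √w) (h1 : c ≤ 1)
    (hc : c * gaussInt (17 / 10) ≤ gaussInt z) : c ≤ gaussBound y w :=
  le_min h1 ((le_div_iff₀ gaussInt_cutoff_pos).2 (hc.trans (gaussInt_strictMono.monotone hz)))

lemma gaussBound_eq_one {y w : ℝ} (h : 17 / 10 ≤ y / √w) : gaussBound y w = 1 :=
  le_antisymm (gaussBound_le_one _ _) (le_gaussBound h le_rfl (by simp))

lemma half_le_gaussBound {y w : ℝ} (h : 1 ≤ y / √w) : 1 / 2 ≤ gaussBound y w := by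
  refine le_gaussBound h (by norm_num) ?_
  have h1 := gaussInt_cutoff_le
  have h2 : 8 / 10 ≤ gaussInt 1 := by
    refine le_trans ?_ (le_gaussInt (by norm_num) 2 (by decide))
    norm_num [gaussTaylor, Finset.sum_range_succ, Nat.factorial]
  linarith

lemma le_div_sqrt {c y w : ℝ} (hy : 0 ≤ y) (hw : 0 < w) (h : c ^ 2 * w ≤ y ^ 2) :
    c ≤ y / √w := by
  rw [le_div_iff₀ (sqrt_pos.2 hw)]
  apply le_of_sq_le_sq _ hy
  rw [mul_pow, sq_sqrt hw.le]
  exact h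

/-- Step of the killed walk for which the downward jump kills. -/
lemma gaussBound_step_dead {y w a : ℝ} (ha : 0 ≤ a) (hay : a ≤ y) (haw : a ^ 2 < w) :
    gaussBound (y + a) (w - a ^ 2) / 2 ≤ gaussBound y w := by
  have hw : 0 < w := by nlinarith
  have hy := ha.trans hay
  have hc := gaussInt_cutoff_pos
  by_cases h : y ^ 2 * (w + 2 * a ^ 2) ≤ 3 * w ^ 2
  · have h1 := gaussInt_step ha haw hy h
    have h2 : 0 ≤ gaussInt ((y - a) / √(w - a ^ 2)) :=
      gaussInt_nonneg (div_nonneg (by linarith) (sqrt_nonneg _))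
    refine le_min (by linarith [gaussBound_le_one (y + a) (w - a ^ 2)]) ?_
    have h3 := gaussBound_le (y + a) (w - a ^ 2)
    rw [le_div_iff₀ hc] at h3 ⊢
    linarith
  · push Not at h
    have : 1 / 2 ≤ gaussBound y w := by
      refine half_le_gaussBound (le_div_sqrt hy hw ?_)
      by_contra! h'
      nlinarith [mul_nonneg (sq_nonneg y) (sq_nonneg a)]
    linarith [gaussBound_le_one (y + a) (w - a ^ 2)]

lemma octic_nonneg {t : ℝ} (h0 : 0 ≤ t) (h1 : t ≤ 573 / 1000) :
    (17 / 10 * (1 - t ^ 2) - 2 * t) ^ 2 * (1 + 10 * t ^ 2 + t ^ 4) ≤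
      3 * ((1 - 3 * t ^ 2) * (1 + t ^ 2)) ^ 2 := by
  rcases le_total t (3 / 10) with h | h
  · have hu : 0 ≤ 3 / 10 - t := by linarith
    have key (i j : ℕ) : 0 ≤ t ^ i * (3 / 10 - t) ^ j := by positivity
    linarith [key 0 8, key 1 7, key 2 6, key 3 5, key 4 4, key 5 3, key 6 2, key 7 1, key 8 0]
  · have hu : 0 ≤ 573 / 1000 - t := by linarith
    have hv : 0 ≤ t - 3 / 10 := by linarith
    have key (i j : ℕ) : 0 ≤ (t - 3 / 10) ^ i * (573 / 1000 - t) ^ j := by positivity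
    linarith [key 0 8, key 1 7, key 2 6, key 3 5, key 4 4, key 5 3, key 6 2, key 7 1, key 8 0]

lemma unit_circle_ineq {q R : ℝ} (hq : 0 ≤ q) (hR : 0 ≤ R) (h : R ^ 2 + q ^ 2 = 1)
    (hle : q ≤ 17 / 10 * R) :
    (17 / 10 * R - q) ^ 2 * (1 + 2 * q ^ 2) ≤ 3 * (2 * R - 1) ^ 2 := by
  set t := q / (1 + R) with ht
  have ht0 : 0 ≤ t := by positivity
  have hq' : q = t * (1 + R) := by rw [ht]; field_simp
  have hR' : R * (1 + t ^ 2) = 1 - t ^ 2 := by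
    rw [hq'] at h
    have : (1 + R) * (R * (1 + t ^ 2) - (1 - t ^ 2)) = 0 := by linear_combination h
    rcases mul_eq_zero.1 this with h' | h' <;> linarith
  have hp : 0 < 1 + t ^ 2 := by positivity
  have eR : R = (1 - t ^ 2) / (1 + t ^ 2) := by rw [eq_div_iff hp.ne', hR']
  have eq : q = 2 * t / (1 + t ^ 2) := by
    rw [eq_div_iff hp.ne', hq']; linear_combination t * hR'
  have hle' : 2 * t ≤ 17 / 10 * (1 - t ^ 2) := by
    have h1 := mul_le_mul_of_nonneg_right hle hp.le
    rw [eq_div_iff hp.ne'] at eq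
    linarith
  have := octic_nonneg ht0 (by nlinarith)
  have e1 : (17 / 10 * R - q) ^ 2 * (1 + 2 * q ^ 2) =
      (17 / 10 * (1 - t ^ 2) - 2 * t) ^ 2 * (1 + 10 * t ^ 2 + t ^ 4) / (1 + t ^ 2) ^ 4 := by
    rw [eq, eR]; field_simp; ring
  have e2 : 3 * (2 * R - 1) ^ 2 =
      3 * ((1 - 3 * t ^ 2) * (1 + t ^ 2)) ^ 2 / (1 + t ^ 2) ^ 4 := by
    rw [eR]; field_simp; ring
  rw [e1, e2]
  gcongr

/-- Step of the killed walk for which both jumps survive. -/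
lemma gaussBound_step_alive {y w a : ℝ} (ha : 0 ≤ a) (hay : a ≤ y) (haw : a ^ 2 < w)
    (hstep : a ^ 2 ≤ 3 / 4 * w ∨ (17 / 10) ^ 2 * w ≤ y ^ 2) :
    (gaussBound (y - a) (w - a ^ 2) + gaussBound (y + a) (w - a ^ 2)) / 2 ≤ gaussBound y w := by
  have hw : 0 < w := by nlinarith
  have hy := ha.trans hay
  have hc := gaussInt_cutoff_pos
  have u1 := gaussBound_le_one (y - a) (w - a ^ 2)
  have u2 := gaussBound_le_one (y + a) (w - a ^ 2)
  have v1 := gaussBound_le (y - a) (w - a ^ 2)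
  have v2 := gaussBound_le (y + a) (w - a ^ 2)
  rw [le_div_iff₀ hc] at v1 v2
  by_cases hlarge : (17 / 10) ^ 2 * w ≤ y ^ 2
  · rw [gaussBound_eq_one (le_div_sqrt hy hw hlarge)]
    linarith
  replace hstep := hstep.resolve_right hlarge
  refine le_min (by linarith) ?_
  rw [le_div_iff₀ hc]
  by_cases h : y ^ 2 * (w + 2 * a ^ 2) ≤ 3 * w ^ 2
  · linarith [gaussInt_step ha haw hy h]
  push Not at h
  have hr : 0 < √w := sqrt_pos.2 hw
  have hr2 := sq_sqrt hw.le
  have hs : 0 < √(w - a ^ 2) := sqrt_pos.2 (by linarith)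
  have hs2 := sq_sqrt (show 0 ≤ w - a ^ 2 by linarith)
  set r := √w
  set ρ := √(w - a ^ 2)
  set z := y / r with hz
  set q := a / r with hq
  set R := ρ / r with hR
  have hyz : y = z * r := by rw [hz]; field_simp
  have haq : a = q * r := by rw [hq]; field_simp
  have hρ : ρ = R * r := by rw [hR]; field_simp
  have hq0 : 0 ≤ q := by positivity
  have hR0 : 0 < R := by positivity
  have hz0 : 0 ≤ z := by positivity
  have hcirc : R ^ 2 + q ^ 2 = 1 := by
    rw [hR, hq, div_pow, div_pow, hs2, hr2]; field_simp; ring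
  have hq2 : q ^ 2 ≤ 3 / 4 := by
    rw [hq, div_pow, hr2, div_le_iff₀ hw]; exact hstep
  have hR2 : 1 / 2 ≤ R := by nlinarith
  have hz2 : 3 ≤ z ^ 2 * (1 + 2 * q ^ 2) := by
    rw [hz, hq, div_pow, div_pow, hr2]
    have e : y ^ 2 / w * (1 + 2 * (a ^ 2 / w)) = y ^ 2 * (w + 2 * a ^ 2) / w ^ 2 := by
      field_simp
    rw [e, le_div_iff₀ (by positivity)]
    exact h.le
  have hmain : 17 / 10 * R - q ≤ z * (2 * R - 1) := by
    rcases le_total (17 / 10 * R) q with h' | h'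
    · have : 0 ≤ z * (2 * R - 1) := mul_nonneg hz0 (by linarith)
      linarith
    · have h1 := unit_circle_ineq hq0 hR0.le hcirc h'
      have h2 := mul_le_mul_of_nonneg_right hz2 (sq_nonneg (2 * R - 1))
      have h3 : (17 / 10 * R - q) ^ 2 * (1 + 2 * q ^ 2) ≤
          (z * (2 * R - 1)) ^ 2 * (1 + 2 * q ^ 2) := by linarith
      exact le_of_sq_le_sq (le_of_mul_le_mul_right h3 (by positivity))
        (mul_nonneg hz0 (by linarith))
  have hz' : (y - a) / ρ = (z - q) / R := by
    rw [hyz, haq, hρ]; field_simp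
  have hz'0 : 0 ≤ (y - a) / ρ := div_nonneg (by linarith) hs.le
  have hsum : 17 / 10 + (y - a) / ρ ≤ 2 * z := by
    rw [hz', ← sub_nonneg]
    have e : 2 * z - (17 / 10 + (z - q) / R) =
        (z * (2 * R - 1) - (17 / 10 * R - q)) / R := by field_simp; ring
    rw [e]
    exact div_nonneg (by linarith) hR0.le
  have := gaussInt_add_le (by norm_num) hz'0 hsum
  have v3 : gaussBound (y + a) (w - a ^ 2) * gaussInt (17 / 10) ≤ gaussInt (17 / 10) :=
    mul_le_of_le_one_left hc.le u2
  linarith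

lemma cos_le_exp_neg {u : ℝ} (h0 : 0 ≤ u) (h1 : u ≤ 1) : cos u ≤ exp (-(u ^ 2 / 2)) := by
  have hc := (abs_le.1 (cos_bound (abs_le.2 ⟨by linarith, h1⟩))).2
  have he := exp_neg_alternating 4 (u := u ^ 2 / 2) (by positivity)
  rw [abs_of_nonneg h0] at hc
  norm_num [Finset.sum_range_succ, Nat.factorial] at he
  nlinarith [pow_nonneg h0 4, mul_nonneg (pow_nonneg h0 4) (sub_nonneg.2 (pow_le_one₀ h0 h1 :
    u ^ 2 ≤ 1))]

lemma gaussBound_mono {y y' w w' : ℝ} (hy : 0 ≤ y) (hyy : y ≤ y') (hw : 0 < w') (hww : w' ≤ w) :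
    gaussBound y w ≤ gaussBound y' w' := by
  refine min_le_min le_rfl (div_le_div_of_nonneg_right ?_ gaussInt_cutoff_pos.le)
  apply gaussInt_strictMono.monotone
  have : 0 < √w' := sqrt_pos.2 hw
  have := hy.trans hyy
  gcongr

/-- Amplitudes of the correction term while the walk is below the next big jump. -/
def amplBelow (h b H : ℝ) : ℕ → ℝ
  | 0 => 0
  | 1 => h
  | 2 => b
  | _ => H

/-- Amplitudes of the correction term while the walk is above the next big jump. -/
def amplAbove (h H : ℝ) : ℕ → ℝ
  | 0 => 0
  | 1 => h
  | 2 => h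
  | _ => H

/-- The correction term added to `gaussBound`: `B` is the increasing list of the remaining big
jumps, `s` bounds the small ones, and `lam` is the frequency of the sine profile. -/
noncomputable def correction (s lam h b H : ℝ) : List ℝ → ℝ → ℝ
  | [], _ => 0
  | c :: B, y =>
    if y < c then amplBelow h b H (B.length + 1) * sin (lam * y)
    else if y < c + s then amplAbove h H B.length / 2
    else amplAbove h H (B.length + 1)

/-- Admissible constants for the potential argument. -/
structure Admissible (s lam σ h b H : ℝ) : Prop where
  s_pos : 0 < s
  s_le : s ≤ 1 / 2
  lam_ge : 1.06 ≤ lam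
  lam_le : lam * (1 + s) ≤ 2.61
  lam_mul_le : lam * s ≤ 1
  sin_ge : σ ≤ sin (lam * s)
  h_nonneg : 0 ≤ h
  h_le_b : h ≤ b
  h_le_H : h ≤ H
  avg_le : (b + h) / 2 ≤ H
  crit : 1 ≤ gaussBound ((1 + s) * √3 / 2) 1 +
    exp (-(lam ^ 2 / 2 * (1 / 3 - s ^ 2 / (17 / 10) ^ 2))) * h
  exhausted : ∀ r : ℕ, r < 7 → (positivePaths (r + 1) 1 : ℝ) / 2 ^ (r + 1) ≤
    gaussBound s ((r + 1 : ℕ) + s ^ 2 / (17 / 10) ^ 2) + amplBelow h b H (r + 1) * σ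

namespace Admissible

variable {s lam σ h b H : ℝ}

lemma H_nonneg (hA : Admissible s lam σ h b H) : 0 ≤ H := hA.h_nonneg.trans hA.h_le_H

lemma amplBelow_nonneg (hA : Admissible s lam σ h b H) (r : ℕ) : 0 ≤ amplBelow h b H r := by
  have := hA.h_nonneg
  have := hA.h_le_b
  have := hA.h_le_H
  unfold amplBelow
  split <;> linarith

lemma amplAbove_nonneg (hA : Admissible s lam σ h b H) (r : ℕ) : 0 ≤ amplAbove h H r := by
  have := hA.h_nonneg
  have := hA.h_le_H
  unfold amplAbove
  split <;> linarith

lemma amplAbove_le (hA : Admissible s lam σ h b H) (r : ℕ) : amplAbove h H r ≤ H := by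
  have := hA.h_nonneg
  have := hA.h_le_H
  unfold amplAbove
  split <;> linarith

lemma amplAbove_le_succ (hA : Admissible s lam σ h b H) (r : ℕ) : amplAbove h H r ≤ amplAbove h H
    (r + 1) := by
  have := hA.h_nonneg
  have := hA.h_le_H
  rcases r with _ | _ | _ | r <;> simp only [amplAbove] <;> linarith

lemma amplAbove_le_amplBelow (hA : Admissible s lam σ h b H) (r : ℕ) :
    amplAbove h H r ≤ amplBelow h b H (r + 1) := by
  have := hA.h_nonneg
  have := hA.h_le_H
  have := hA.h_le_b
  rcases r with _ | _ | _ | r <;> simp only [amplAbove, amplBelow] <;> linarith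

lemma ampl_avg_le (hA : Admissible s lam σ h b H) (r : ℕ) :
    (amplBelow h b H r + amplAbove h H r) / 2 ≤ amplAbove h H (r + 1) := by
  have := hA.h_nonneg
  have := hA.h_le_H
  have := hA.avg_le
  rcases r with _ | _ | _ | r <;> simp only [amplAbove, amplBelow] <;> linarith

lemma half_le_sin (hA : Admissible s lam σ h b H) {y : ℝ} (h0 : 1 / 2 ≤ y) (h1 : y ≤ 1 + s) :
    1 / 2 ≤ sin (lam * y) := by
  have hl := hA.lam_ge
  have h2 : lam * y ≤ 2.61 := le_trans (by gcongr) hA.lam_le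
  have h3 : (1.06 : ℝ) * (1 / 2) ≤ lam * y := by gcongr
  have := pi_gt_d2
  have := pi_lt_d2
  rw [← sin_pi_div_six]
  rcases le_total (lam * y) (π / 2) with h | h
  · exact sin_le_sin_of_le_of_le_pi_div_two (by linarith) h (by linarith)
  · rw [← sin_pi_sub (lam * y)]
    exact sin_le_sin_of_le_of_le_pi_div_two (by linarith) (by linarith) (by linarith)

lemma sin_nonneg (hA : Admissible s lam σ h b H) {y : ℝ} (h0 : 0 ≤ y) (h1 : y ≤ 1 + s) : 0 ≤ sin
    (lam * y) := by
  have hl := hA.lam_ge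
  have h2 : lam * y ≤ 2.61 := le_trans (by gcongr) hA.lam_le
  have := pi_gt_d2
  exact sin_nonneg_of_nonneg_of_le_pi (by positivity) (by linarith)

lemma le_sin (hA : Admissible s lam σ h b H) {y : ℝ} (h0 : s ≤ y) (h1 : y ≤ 1) : σ ≤ sin
    (lam * y) := by
  refine hA.sin_ge.trans ?_
  have hl := hA.lam_ge
  have hs := hA.s_pos
  have hs' := hA.s_le
  have h2 : lam * y ≤ lam * 1 := by gcongr
  have h3 : lam * s ≤ lam * y := by gcongr
  have h4 := hA.lam_le
  have h5 : 0 ≤ lam * s := by positivity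
  have := pi_gt_d2
  rcases le_total (lam * y) (π / 2) with h | h
  · exact sin_le_sin_of_le_of_le_pi_div_two (by linarith) h h3
  · rw [← sin_pi_sub (lam * y)]
    exact sin_le_sin_of_le_of_le_pi_div_two (by linarith) (by linarith) (by linarith)

lemma correction_nonneg (hA : Admissible s lam σ h b H) {B : List ℝ} (hB : ∀ c ∈ B, c ≤ 1) {y : ℝ}
    (hy : 0 ≤ y) :
    0 ≤ correction s lam h b H B y := by
  rcases B with _ | ⟨c, B⟩
  · exact le_rfl
  have := hA.s_pos
  have hc := hB c (by simp)
  rw [correction]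
  split_ifs with h1 h2
  · exact mul_nonneg (hA.amplBelow_nonneg _) (hA.sin_nonneg hy (by linarith))
  · linarith [hA.amplAbove_nonneg B.length]
  · exact hA.amplAbove_nonneg _

lemma correction_le (hA : Admissible s lam σ h b H) {B : List ℝ} {y : ℝ} :
    correction s lam h b H B y ≤ max (amplBelow h b H B.length) (amplAbove h H B.length) := by
  rcases B with _ | ⟨c, B⟩
  · exact le_max_of_le_left le_rfl
  rw [correction]
  split_ifs with h1 h2
  · exact le_max_of_le_left (mul_le_of_le_one_right (hA.amplBelow_nonneg _) (sin_le_one _))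
  · refine le_max_of_le_right ?_
    rw [List.length_cons]
    linarith [hA.amplAbove_nonneg B.length, hA.amplAbove_le_succ B.length]
  · exact le_max_of_le_right le_rfl

lemma correction_le_of_head_le (hA : Admissible s lam σ h b H) {B : List ℝ} {y : ℝ}
    (hB : ∀ c ∈ B, c ≤ y) :
    correction s lam h b H B y ≤ amplAbove h H B.length := by
  rcases B with _ | ⟨c, B⟩
  · exact le_rfl
  have := hB c (by simp)
  rw [correction]
  rw [if_neg (by linarith), List.length_cons]
  split_ifs
  · linarith [hA.amplAbove_nonneg B.length, hA.amplAbove_le_succ B.length]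
  · exact le_rfl

/-- Averaging the correction over a small jump. -/
lemma correction_small_step (hA : Admissible s lam σ h b H) {c : ℝ} {B : List ℝ}
    (hB : ∀ d ∈ c :: B, d ∈ Set.Icc (1 / 2) 1)
    {y a : ℝ} (ha : 0 ≤ a) (has : a ≤ s) (hsy : s < y) (hyc : y < c) :
    (correction s lam h b H (c :: B) (y - a) + correction s lam h b H (c :: B) (y + a)) / 2 ≤
      exp (-(lam ^ 2 / 2 * a ^ 2)) * correction s lam h b H (c :: B) y := by
  have hc := hB c (by simp)
  have hs := hA.s_pos
  have hl := hA.lam_ge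
  set β := amplBelow h b H (B.length + 1)
  have hβ : 0 ≤ β := hA.amplBelow_nonneg _
  have e1 : correction s lam h b H (c :: B) (y - a) = β * sin (lam * (y - a)) := by
    rw [correction, if_pos (by linarith)]
  have e2 : correction s lam h b H (c :: B) y = β * sin (lam * y) := by
    rw [correction, if_pos (by linarith)]
  have e3 : correction s lam h b H (c :: B) (y + a) ≤ β * sin (lam * (y + a)) := by
    rw [correction]
    split_ifs with h1 h2
    · exact le_rfl
    · have h3 := hA.half_le_sin (y := y + a) (by linarith [hc.1]) (by linarith [hc.2])
      have h4 := mul_le_mul_of_nonneg_left h3 hβ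
      linarith [hA.amplAbove_le_amplBelow B.length]
    · linarith
  have e4 : sin (lam * (y - a)) + sin (lam * (y + a)) = 2 * (sin (lam * y) * cos (lam * a)) := by
    rw [mul_sub, mul_add, sin_sub, sin_add]; ring
  have hu : lam * a ≤ 1 := le_trans (by gcongr) hA.lam_mul_le
  have hcos := cos_le_exp_neg (u := lam * a) (by positivity) hu
  rw [show (lam * a) ^ 2 / 2 = lam ^ 2 / 2 * a ^ 2 by ring] at hcos
  have hsin : 0 ≤ β * sin (lam * y) :=
    mul_nonneg hβ (hA.sin_nonneg (by linarith) (by linarith [hc.2]))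
  have h5 := mul_le_mul_of_nonneg_left hcos hsin
  rw [e1, e2]
  have h6 : β * sin (lam * (y - a)) + β * sin (lam * (y + a)) =
      2 * (β * sin (lam * y) * cos (lam * a)) := by rw [← mul_add, e4]; ring
  linarith

end Admissible

namespace Admissible

variable {s lam σ h b H : ℝ}

lemma gaussBound_le_of_small_step {y w a A B C D ε : ℝ} (ha : 0 ≤ a) (has : a ≤ s)
    (hsy : s < y) (haw : a ^ 2 < w) (hA1 : A ≤ gaussBound (y + a) (w - a ^ 2) + ε * D)
    (hA2 : s < y - a → B ≤ gaussBound (y - a) (w - a ^ 2) + ε * C) (hB : y - a ≤ s → B = 0)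
    (hε : 0 ≤ ε) (hC : 0 ≤ C) {E : ℝ} (hE : ε * ((C + D) / 2) ≤ E) :
    (B + A) / 2 ≤ gaussBound y w + E := by
  have hCε := mul_nonneg hε hC
  by_cases hdead : y - a ≤ s
  · rw [hB hdead]
    have := gaussBound_step_dead (y := y) ha (by linarith) haw
    linarith
  · push Not at hdead
    have hw : 0 < w := by nlinarith
    have hstep : a ^ 2 ≤ 3 / 4 * w ∨ (17 / 10) ^ 2 * w ≤ y ^ 2 := by
      by_contra! hcon
      nlinarith
    linarith [hA2 hdead, gaussBound_step_alive ha (by linarith) haw hstep]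

lemma last_big_step (hA : Admissible s lam σ h b H) {c y v : ℝ} (hc : c ∈ Set.Icc (1 / 2) 1)
    (hv : 0 ≤ v) (hcy : c + s ≤ y)
    (hw : 3 / 4 * (c ^ 2 + v + s ^ 2 / (17 / 10) ^ 2) < c ^ 2) :
    1 ≤ gaussBound y (c ^ 2 + v + s ^ 2 / (17 / 10) ^ 2) + exp (-(lam ^ 2 / 2 * v)) * h := by
  have hs := hA.s_pos
  have hδ : 0 < s ^ 2 / (17 / 10) ^ 2 := by positivity
  set δ := s ^ 2 / (17 / 10) ^ 2
  obtain ⟨hc0, hc1⟩ := hc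
  have hcc : c ^ 2 ≤ 1 := pow_le_one₀ (by linarith) hc1
  refine hA.crit.trans (add_le_add ?_ ?_)
  · have h1 : (1 + s) * √3 / 2 ≤ y / √(c ^ 2 + v + δ) := by
      refine le_div_sqrt (by linarith) (by positivity) ?_
      rw [div_pow, mul_pow, sq_sqrt (by norm_num)]
      have h2 : c * (1 + s) ≤ y := by nlinarith
      have h3 : (c * (1 + s)) ^ 2 ≤ y ^ 2 := by gcongr
      have h4 := mul_le_mul_of_nonneg_left hw.le (sq_nonneg (1 + s))
      linarith
    refine min_le_min le_rfl (div_le_div_of_nonneg_right ?_ gaussInt_cutoff_pos.le)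
    apply gaussInt_strictMono.monotone
    simpa using h1
  · have h1 : v ≤ 1 / 3 - δ := by linarith
    have := hA.h_nonneg
    gcongr

theorem smallBall_le (hA : Admissible s lam σ h b H) {B S : List ℝ}
    (hB : ∀ c ∈ B, c ∈ Set.Icc (1 / 2) 1) (hBs : B.Pairwise (· ≤ ·)) (hBl : B.length ≤ 7)
    (hS : ∀ a ∈ S, a ∈ Set.Icc 0 s) {y : ℝ} (hy : s < y) :
    smallBall (B ++ S) 0 (y - s) ≤
      gaussBound y (sumSq B + sumSq S + s ^ 2 / (17 / 10) ^ 2) +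
        exp (-(lam ^ 2 / 2 * sumSq S)) * correction s lam h b H B y := by
  have hs := hA.s_pos
  have hδ : 0 < s ^ 2 / (17 / 10) ^ 2 := by positivity
  have hδs : (17 / 10) ^ 2 * (s ^ 2 / (17 / 10) ^ 2) = s ^ 2 := by field_simp
  set δ := s ^ 2 / (17 / 10) ^ 2
  induction hn : B.length + S.length generalizing B S y with
  | zero =>
    obtain rfl : B = [] := List.length_eq_zero_iff.1 (by omega)
    obtain rfl : S = [] := List.length_eq_zero_iff.1 (by omega)
    rw [gaussBound_eq_one]
    · simpa [correction] using smallBall_le_one [] 0 (y - s)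
    · refine le_div_sqrt (by linarith) (by simpa using hδ) ?_
      simp only [sumSq_nil, zero_add]
      rw [hδs]
      gcongr
  | succ n ih =>
    have hvB := sumSq_nonneg B
    have small (c : ℝ → ℝ) (hc : c = correction s lam h b H B) (a : ℝ) (S' : List ℝ)
        (hSS : S = a :: S') (hcn : 0 ≤ c (y - a))
        (hcorr : (c (y - a) + c (y + a)) / 2 ≤ exp (-(lam ^ 2 / 2 * a ^ 2)) * c y) :
        smallBall (B ++ S) 0 (y - s) ≤ gaussBound y (sumSq B + sumSq S + δ) +
          exp (-(lam ^ 2 / 2 * sumSq S)) * c y := by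
      subst hSS hc
      have ha := hS a (by simp)
      have hS' : ∀ d ∈ S', d ∈ Set.Icc 0 s := fun d hd => hS d (by simp [hd])
      have hvS := sumSq_nonneg S'
      rw [smallBall_perm List.perm_middle]
      refine (smallBall_cons_le _ _ ha.1).trans ?_
      have e : sumSq B + sumSq (a :: S') + δ - a ^ 2 = sumSq B + sumSq S' + δ := by
        rw [sumSq_cons]; ring
      refine gaussBound_le_of_small_step (s := s) (a := a) ha.1 ha.2 hy
        (by rw [sumSq_cons]; linarith) (D := correction s lam h b H B (y + a))
        (C := correction s lam h b H B (y - a)) (ε := exp (-(lam ^ 2 / 2 * sumSq S')))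
        ?_ ?_ ?_ (exp_pos _).le hcn ?_
      · rw [e, show y - s + a = y + a - s by ring]
        exact ih hB hBs hBl hS' (by linarith [ha.1]) (by simp at hn ⊢; omega)
      · intro h'
        rw [e, show y - s - a = y - a - s by ring]
        exact ih hB hBs hBl hS' h' (by simp at hn ⊢; omega)
      · intro h'
        exact smallBall_of_nonpos _ _ (by linarith)
      · rw [sumSq_cons, mul_add, neg_add_rev, exp_add, mul_assoc]
        gcongr
    rcases B with _ | ⟨c, B⟩
    · rcases S with _ | ⟨a, S'⟩
      · simp at hn
      exact small _ rfl a S' rfl le_rfl (by simp [correction])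
    have hc := hB c (by simp)
    have hcB : ∀ d ∈ B, c ≤ d := (List.pairwise_cons.1 hBs).1
    have hB1 : ∀ d ∈ c :: B, d ≤ 1 := fun d hd => (hB d hd).2
    have hB' : ∀ d ∈ B, d ∈ Set.Icc (1 / 2) 1 := fun d hd => hB d (by simp [hd])
    have hB1' : ∀ d ∈ B, d ≤ 1 := fun d hd => (hB' d hd).2
    have hBs' := (List.pairwise_cons.1 hBs).2
    by_cases hyc : y < c
    · rcases S with _ | ⟨a, S'⟩
      · rw [sumSq_nil, mul_zero, neg_zero, exp_zero, one_mul, add_zero]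
        refine (smallBall_le_positivePaths (c :: B) [] 1 (c := c) (by linarith [hc.1]) ?_ ?_).trans
          ?_
        · exact List.pairwise_cons.2 ⟨fun d hd => by
            rcases List.mem_cons.1 hd with rfl | hd
            · exact le_rfl
            · exact hcB d hd, hBs⟩
        · push_cast; linarith
        · refine (hA.exhausted B.length (by simpa using hBl)).trans (add_le_add ?_ ?_)
          · refine gaussBound_mono hs.le hy.le (by linarith [hc.1]) ?_
            gcongr
            exact sumSq_le_length fun d hd => ⟨by linarith [(hB d hd).1], hB1 d hd⟩
          · rw [correction, if_pos hyc]
            exact mul_le_mul_of_nonneg_left (hA.le_sin hy.le (by linarith [hc.2]))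
              (hA.amplBelow_nonneg _)
      · have ha := hS a (by simp)
        exact small _ rfl a S' rfl (hA.correction_nonneg hB1 (by linarith [ha.2]))
          (hA.correction_small_step hB ha.1 ha.2 hy hyc)
    · push Not at hyc
      have hvS := sumSq_nonneg S
      have hvB' := sumSq_nonneg B
      have hc0 : 0 ≤ c := by linarith [hc.1]
      have hcw : c ^ 2 < sumSq (c :: B) + sumSq S + δ := by rw [sumSq_cons]; linarith
      have e : sumSq (c :: B) + sumSq S + δ - c ^ 2 = sumSq B + sumSq S + δ := by
        rw [sumSq_cons]; ring
      have hlen : B.length + S.length = n := by simp at hn; omega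
      have hBl' : B.length ≤ 7 := by simp at hBl; omega
      have hup := ih hB' hBs' hBl' hS (y := y + c) (by linarith)  hlen
      have hcup : correction s lam h b H B (y + c) ≤ amplAbove h H B.length :=
        hA.correction_le_of_head_le fun d hd => by linarith [hc.1, hB1' d hd]
      have hE : 0 < exp (-(lam ^ 2 / 2 * sumSq S)) := exp_pos _
      have hcup' := mul_le_mul_of_nonneg_left hcup hE.le
      have hsucc := mul_le_mul_of_nonneg_left (hA.amplAbove_le_succ B.length) hE.le
      have hnn := mul_nonneg hE.le (hA.amplAbove_nonneg B.length)
      by_cases hdead : y ≤ c + s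
      · have h1 : exp (-(lam ^ 2 / 2 * sumSq S)) * amplAbove h H B.length / 2 ≤
            exp (-(lam ^ 2 / 2 * sumSq S)) * correction s lam h b H (c :: B) y := by
          rw [correction, if_neg (not_lt.2 hyc)]
          split_ifs
          · rw [mul_div_assoc]
          · linarith
        have h2 := smallBall_cons_le (B ++ S) (y - s) hc0
        rw [smallBall_of_nonpos _ _ (show y - s - c ≤ 0 by linarith),
          show y - s + c = y + c - s by ring] at h2
        have h3 := gaussBound_step_dead hc0 hyc hcw
        rw [e] at h3
        rw [List.cons_append]
        linarith
      · push Not at hdead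
        have e2 : correction s lam h b H (c :: B) y = amplAbove h H (B.length + 1) := by
          rw [correction, if_neg (not_lt.2 hyc), if_neg (not_lt.2 hdead.le)]
        rw [e2]
        by_cases hw : c ^ 2 ≤ 3 / 4 * (sumSq (c :: B) + sumSq S + δ)
        · have h2 := smallBall_cons_le (B ++ S) (y - s) hc0
          rw [show y - s - c = y - c - s by ring, show y - s + c = y + c - s by ring] at h2
          have h3 := gaussBound_step_alive hc0 hyc hcw (Or.inl hw)
          rw [e] at h3
          have hdown := ih hB' hBs' hBl' hS (y := y - c) (by linarith) hlen
          have h4 : correction s lam h b H B (y - c) + correction s lam h b H B (y + c) ≤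
              2 * amplAbove h H (B.length + 1) := by
            have h5 := hA.correction_le (B := B) (y := y - c)
            rcases max_cases (amplBelow h b H B.length) (amplAbove h H B.length) with
              ⟨h6, _⟩ | ⟨h6, _⟩ <;> rw [h6] at h5
            · linarith [hA.ampl_avg_le B.length]
            · linarith [hA.amplAbove_le_succ B.length]
          have h5 := mul_le_mul_of_nonneg_left h4 hE.le
          rw [List.cons_append]
          linarith
        · push Not at hw
          rcases B with _ | ⟨d, B⟩
          · refine (smallBall_le_one _ _ _).trans ?_
            simpa [amplAbove] using hA.last_big_step hc hvS hdead.le (by simpa using hw)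
          · exfalso
            have hd := hcB d (by simp)
            have := sumSq_nonneg B
            simp only [sumSq_cons] at hw
            nlinarith

/-- The form of the potential bound used in applications. -/
theorem smallBall_one_le (hA : Admissible s lam σ h b H) {B S : List ℝ}
    (hB : ∀ c ∈ B, c ∈ Set.Icc (1 / 2) 1) (hBs : B.Pairwise (· ≤ ·)) (hBl : B.length ≤ 7)
    (hS : ∀ a ∈ S, a ∈ Set.Icc 0 s) {v : ℝ} (hv : v ≤ sumSq S) (htot : sumSq B + sumSq S = 7) :
    smallBall (B ++ S) 0 1 ≤
      gaussBound (1 + s) (7 + s ^ 2 / (17 / 10) ^ 2) + exp (-(lam ^ 2 / 2 * v)) * H := by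
  have h1 := hA.smallBall_le hB hBs hBl hS (y := 1 + s) (by linarith)
  rw [add_sub_cancel_right, htot] at h1
  refine h1.trans ?_
  have hc : correction s lam h b H B (1 + s) ≤ H := by
    rcases B with _ | ⟨c, B⟩
    · exact hA.H_nonneg
    have := (hB c (by simp)).2
    have := hA.s_pos
    rw [correction, if_neg (by linarith), if_neg (by linarith)]
    exact hA.amplAbove_le _
  have := hA.correction_nonneg (fun c hc => (hB c hc).2) (by linarith [hA.s_pos] : 0 ≤ 1 + s)
  gcongr

end Admissible

lemma exp_neg_ge (N : ℕ) (hN : Even N) {u : ℝ} (hu : 0 ≤ u) :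
    ∑ k ∈ Finset.range N, (-u) ^ k / k.factorial ≤ exp (-u) := by
  have := exp_neg_alternating N hu
  rw [hN.neg_one_pow] at this
  linarith

lemma exp_neg_le (N : ℕ) (hN : Odd N) {u : ℝ} (hu : 0 ≤ u) :
    exp (-u) ≤ ∑ k ∈ Finset.range N, (-u) ^ k / k.factorial := by
  have := exp_neg_alternating N hu
  rw [hN.neg_one_pow] at this
  linarith

lemma le_gaussBound_of_taylor {y w : ℝ} (z c : ℝ) (hz : 0 ≤ z ∧ 0 ≤ c ∧ 0 ≤ y ∧ 0 < w)
    (hzw : z ^ 2 * w ≤ y ^ 2) (hc : c * (11418 / 10000) ≤ gaussTaylor 6 z) (h1 : c ≤ 1) :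
    c ≤ gaussBound y w := by
  obtain ⟨hz, hc0, hy, hw⟩ := hz
  refine le_gaussBound (le_div_sqrt hy hw hzw) h1 ?_
  have := le_gaussInt hz 6 (by decide)
  have := mul_le_mul_of_nonneg_left gaussInt_cutoff_le hc0
  linarith

lemma gaussBound_le_of_taylor {y w : ℝ} (z : ℝ) (hz : 0 ≤ z) (hw : 0 < w) (hy : 0 ≤ y)
    (hzw : y ^ 2 ≤ z ^ 2 * w) : gaussBound y w ≤ gaussTaylor 5 z / (11414 / 10000) := by
  refine (gaussBound_le y w).trans ?_
  have h1 : y / √w ≤ z := by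
    rw [div_le_iff₀ (sqrt_pos.2 hw)]
    apply le_of_sq_le_sq _ (by positivity)
    rwa [mul_pow, sq_sqrt hw.le]
  have h2 := (gaussInt_strictMono.monotone h1).trans (gaussInt_le hz 5 (by decide))
  have h3 := gaussInt_nonneg (z := y / √w) (by positivity)
  exact div_le_div₀ (h3.trans h2) h2 (by norm_num) le_gaussInt_cutoff

namespace Admissible

lemma exhausted_of_taylor {s σ β κ w : ℝ} (z c : ℝ) (hz : 0 ≤ z ∧ 0 ≤ c ∧ 0 ≤ s ∧ 0 < w)
    (hzw : z ^ 2 * w ≤ s ^ 2) (hc : c * (11418 / 10000) ≤ gaussTaylor 6 z) (h1 : c ≤ 1)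
    (h : κ ≤ c + β * σ) : κ ≤ gaussBound s w + β * σ := by
  linarith [le_gaussBound_of_taylor z c hz hzw hc h1]

end Admissible

section
open Admissible

lemma admissible_half : Admissible (1 / 2) (174 / 100) (7602 / 10000) (168 / 1000) (267 / 1000)
    (218 / 1000) where
  s_pos := by norm_num
  s_le := by norm_num
  lam_ge := by norm_num
  lam_le := by norm_num
  lam_mul_le := by norm_num
  sin_ge := le_trans (by norm_num) (sin_ge_sub_cube (by norm_num))
  h_nonneg := by norm_num
  h_le_b := by norm_num
  h_le_H := by norm_num
  avg_le := by norm_num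
  crit := by
    refine le_trans ?_ (add_le_add (le_gaussBound_of_taylor (129900 / 100000) (88474 / 100000)
      ⟨by norm_num, by norm_num, by positivity, by norm_num⟩ ?_
      ?_ (by norm_num)) (mul_le_mul_of_nonneg_right (exp_neg_ge 6 (by decide) (by norm_num))
      (by norm_num)))
    · norm_num [Finset.sum_range_succ, Nat.factorial]
    · rw [div_pow (_ * √3), mul_pow, sq_sqrt (by norm_num)]; norm_num
    · norm_num [gaussTaylor, Finset.sum_range_succ, Nat.factorial]
  exhausted := by
    intro r hr
    interval_cases r
    · exact exhausted_of_taylor (47968 / 100000) (40453 / 100000) (by norm_num) (by norm_num)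
        (by norm_num [gaussTaylor, Finset.sum_range_succ, Nat.factorial]) (by norm_num)
        (by norm_num [positivePaths, amplBelow])
    · exact exhausted_of_taylor (34614 / 100000) (29720 / 100000) (by norm_num) (by norm_num)
        (by norm_num [gaussTaylor, Finset.sum_range_succ, Nat.factorial]) (by norm_num)
        (by norm_num [positivePaths, amplBelow])
    · exact exhausted_of_taylor (28460 / 100000) (24593 / 100000) (by norm_num) (by norm_num)
        (by norm_num [gaussTaylor, Finset.sum_range_succ, Nat.factorial]) (by norm_num)
        (by norm_num [positivePaths, amplBelow])
    · exact exhausted_of_taylor (24733 / 100000) (21442 / 100000) (by norm_num) (by norm_num)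
        (by norm_num [gaussTaylor, Finset.sum_range_succ, Nat.factorial]) (by norm_num)
        (by norm_num [positivePaths, amplBelow])
    · exact exhausted_of_taylor (22169 / 100000) (19257 / 100000) (by norm_num) (by norm_num)
        (by norm_num [gaussTaylor, Finset.sum_range_succ, Nat.factorial]) (by norm_num)
        (by norm_num [positivePaths, amplBelow])
    · exact exhausted_of_taylor (20266 / 100000) (17628 / 100000) (by norm_num) (by norm_num)
        (by norm_num [gaussTaylor, Finset.sum_range_succ, Nat.factorial]) (by norm_num)
        (by norm_num [positivePaths, amplBelow])
    · exact exhausted_of_taylor (18782 / 100000) (16353 / 100000) (by norm_num) (by norm_num)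
        (by norm_num [gaussTaylor, Finset.sum_range_succ, Nat.factorial]) (by norm_num)
        (by norm_num [positivePaths, amplBelow])

lemma smallBall_le_half_of_half {B S : List ℝ} (hB : ∀ c ∈ B, c ∈ Set.Icc (1 / 2) 1)
    (hBs : B.Pairwise (· ≤ ·)) (hBl : B.length ≤ 7) (hS : ∀ a ∈ S, a ∈ Set.Icc 0 (1 / 2 : ℝ))
    (hv : 137 / 100 ≤ sumSq S) (htot : sumSq B + sumSq S = 7) : smallBall (B ++ S) 0 1 ≤ 1 / 2 := by
  refine (admissible_half.smallBall_one_le hB hBs hBl hS hv htot).trans ?_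
  refine (add_le_add (gaussBound_le_of_taylor (56348 / 100000) (by norm_num) (by norm_num)
    (by norm_num) (by norm_num)) (mul_le_mul_of_nonneg_right
      (exp_neg_le 9 (by decide) (by norm_num)) (by norm_num))).trans ?_
  norm_num [gaussTaylor, Finset.sum_range_succ, Nat.factorial]

lemma admissible_eleven : Admissible (11 / 25) (18125 / 10000) (7129 / 10000) (2102 / 10000)
    (3315 / 10000) (2709 / 10000) where
  s_pos := by norm_num
  s_le := by norm_num
  lam_ge := by norm_num
  lam_le := by norm_num
  lam_mul_le := by norm_num
  sin_ge := le_trans (by norm_num) (sin_ge_sub_cube (by norm_num))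
  h_nonneg := by norm_num
  h_le_b := by norm_num
  h_le_H := by norm_num
  avg_le := by norm_num
  crit := by
    refine le_trans ?_ (add_le_add (le_gaussBound_of_taylor (124703 / 100000) (86451 / 100000)
      ⟨by norm_num, by norm_num, by positivity, by norm_num⟩ ?_
      ?_ (by norm_num)) (mul_le_mul_of_nonneg_right (exp_neg_ge 6 (by decide) (by norm_num))
      (by norm_num)))
    · norm_num [Finset.sum_range_succ, Nat.factorial]
    · rw [div_pow (_ * √3), mul_pow, sq_sqrt (by norm_num)]; norm_num
    · norm_num [gaussTaylor, Finset.sum_range_succ, Nat.factorial]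
  exhausted := by
    intro r hr
    interval_cases r
    · exact exhausted_of_taylor (42596 / 100000) (36207 / 100000) (by norm_num) (by norm_num)
        (by norm_num [gaussTaylor, Finset.sum_range_succ, Nat.factorial]) (by norm_num)
        (by norm_num [positivePaths, amplBelow])
    · exact exhausted_of_taylor (30604 / 100000) (26390 / 100000) (by norm_num) (by norm_num)
        (by norm_num [gaussTaylor, Finset.sum_range_succ, Nat.factorial]) (by norm_num)
        (by norm_num [positivePaths, amplBelow])
    · exact exhausted_of_taylor (25124 / 100000) (21774 / 100000) (by norm_num) (by norm_num)
        (by norm_num [gaussTaylor, Finset.sum_range_succ, Nat.factorial]) (by norm_num)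
        (by norm_num [positivePaths, amplBelow])
    · exact exhausted_of_taylor (21818 / 100000) (18957 / 100000) (by norm_num) (by norm_num)
        (by norm_num [gaussTaylor, Finset.sum_range_succ, Nat.factorial]) (by norm_num)
        (by norm_num [positivePaths, amplBelow])
    · exact exhausted_of_taylor (19546 / 100000) (17010 / 100000) (by norm_num) (by norm_num)
        (by norm_num [gaussTaylor, Finset.sum_range_succ, Nat.factorial]) (by norm_num)
        (by norm_num [positivePaths, amplBelow])
    · exact exhausted_of_taylor (17863 / 100000) (15561 / 100000) (by norm_num) (by norm_num)
        (by norm_num [gaussTaylor, Finset.sum_range_succ, Nat.factorial]) (by norm_num)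
        (by norm_num [positivePaths, amplBelow])
    · exact exhausted_of_taylor (16551 / 100000) (14429 / 100000) (by norm_num) (by norm_num)
        (by norm_num [gaussTaylor, Finset.sum_range_succ, Nat.factorial]) (by norm_num)
        (by norm_num [positivePaths, amplBelow])

lemma smallBall_le_half_of_eleven {B S : List ℝ} (hB : ∀ c ∈ B, c ∈ Set.Icc (1 / 2) 1)
    (hBs : B.Pairwise (· ≤ ·)) (hBl : B.length ≤ 7) (hS : ∀ a ∈ S, a ∈ Set.Icc 0 (11 / 25 : ℝ))
    (hv : 111 / 100 ≤ sumSq S) (htot : sumSq B + sumSq S = 7) : smallBall (B ++ S) 0 1 ≤ 1 / 2 := by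
  refine (admissible_eleven.smallBall_one_le hB hBs hBl hS hv htot).trans ?_
  refine (add_le_add (gaussBound_le_of_taylor (54169 / 100000) (by norm_num) (by norm_num)
    (by norm_num) (by norm_num)) (mul_le_mul_of_nonneg_right
      (exp_neg_le 9 (by decide) (by norm_num)) (by norm_num))).trans ?_
  norm_num [gaussTaylor, Finset.sum_range_succ, Nat.factorial]

lemma admissible_third : Admissible (1 / 3) (19575 / 10000) (6061 / 10000) (361 / 1000)
    (491 / 1000) (426 / 1000) where
  s_pos := by norm_num
  s_le := by norm_num
  lam_ge := by norm_num
  lam_le := by norm_num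
  lam_mul_le := by norm_num
  sin_ge := le_trans (by norm_num) (sin_ge_sub_cube (by norm_num))
  h_nonneg := by norm_num
  h_le_b := by norm_num
  h_le_H := by norm_num
  avg_le := by norm_num
  crit := by
    refine le_trans ?_ (add_le_add (le_gaussBound_of_taylor (115466 / 100000) (82518 / 100000)
      ⟨by norm_num, by norm_num, by positivity, by norm_num⟩ ?_
      ?_ (by norm_num)) (mul_le_mul_of_nonneg_right (exp_neg_ge 6 (by decide) (by norm_num))
      (by norm_num)))
    · norm_num [Finset.sum_range_succ, Nat.factorial]
    · rw [div_pow (_ * √3), mul_pow, sq_sqrt (by norm_num)]; norm_num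
    · norm_num [gaussTaylor, Finset.sum_range_succ, Nat.factorial]
  exhausted := by
    intro r hr
    interval_cases r
    · exact exhausted_of_taylor (32710 / 100000) (28144 / 100000) (by norm_num) (by norm_num)
        (by norm_num [gaussTaylor, Finset.sum_range_succ, Nat.factorial]) (by norm_num)
        (by norm_num [positivePaths, amplBelow])
    · exact exhausted_of_taylor (23346 / 100000) (20262 / 100000) (by norm_num) (by norm_num)
        (by norm_num [gaussTaylor, Finset.sum_range_succ, Nat.factorial]) (by norm_num)
        (by norm_num [positivePaths, amplBelow])
    · exact exhausted_of_taylor (19122 / 100000) (16645 / 100000) (by norm_num) (by norm_num)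
        (by norm_num [gaussTaylor, Finset.sum_range_succ, Nat.factorial]) (by norm_num)
        (by norm_num [positivePaths, amplBelow])
    · exact exhausted_of_taylor (16587 / 100000) (14460 / 100000) (by norm_num) (by norm_num)
        (by norm_num [gaussTaylor, Finset.sum_range_succ, Nat.factorial]) (by norm_num)
        (by norm_num [positivePaths, amplBelow])
    · exact exhausted_of_taylor (14850 / 100000) (12958 / 100000) (by norm_num) (by norm_num)
        (by norm_num [gaussTaylor, Finset.sum_range_succ, Nat.factorial]) (by norm_num)
        (by norm_num [positivePaths, amplBelow])
    · exact exhausted_of_taylor (13564 / 100000) (11843 / 100000) (by norm_num) (by norm_num)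
        (by norm_num [gaussTaylor, Finset.sum_range_succ, Nat.factorial]) (by norm_num)
        (by norm_num [positivePaths, amplBelow])
    · exact exhausted_of_taylor (12564 / 100000) (10974 / 100000) (by norm_num) (by norm_num)
        (by norm_num [gaussTaylor, Finset.sum_range_succ, Nat.factorial]) (by norm_num)
        (by norm_num [positivePaths, amplBelow])

lemma smallBall_le_half_of_third {B S : List ℝ} (hB : ∀ c ∈ B, c ∈ Set.Icc (1 / 2) 1)
    (hBs : B.Pairwise (· ≤ ·)) (hBl : B.length ≤ 7) (hS : ∀ a ∈ S, a ∈ Set.Icc 0 (1 / 3 : ℝ))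
    (hv : 93 / 100 ≤ sumSq S) (htot : sumSq B + sumSq S = 7) : smallBall (B ++ S) 0 1 ≤ 1 / 2 := by
  refine (admissible_third.smallBall_one_le hB hBs hBl hS hv htot).trans ?_
  refine (add_le_add (gaussBound_le_of_taylor (50258 / 100000) (by norm_num) (by norm_num)
    (by norm_num) (by norm_num)) (mul_le_mul_of_nonneg_right
      (exp_neg_le 9 (by decide) (by norm_num)) (by norm_num))).trans ?_
  norm_num [gaussTaylor, Finset.sum_range_succ, Nat.factorial]

end

/-- A supersolution for the walk of small jumps controls the concentration of a sum that has
seven further big jumps. -/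
lemma smallBall_le_of_supersolution {B : List ℝ} {c v₀ : ℝ} (hc : 0 ≤ c)
    (hB : (c :: B).Pairwise (· ≤ ·)) (hBl : B.length = 7) (T : ℝ → ℝ → ℝ)
    (h0 : ∀ X u, c - 1 ≤ X → X ≤ c → 0 ≤ u → u ≤ v₀ → 0 ≤ T X u)
    (h1 : ∀ X u, 2 * c - 1 ≤ X → X ≤ c → 0 ≤ u → u ≤ v₀ → 1 ≤ T X u)
    (h2 : ∀ X, 0 ≤ X → X ≤ 2 * c - 1 → 1 ≤ T X 0)
    (h3 : ∀ X u a, 0 ≤ X → X ≤ 2 * c - 1 → 0 ≤ a → a ≤ 1 - c → a ^ 2 ≤ u → u ≤ v₀ →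
      (T (X - a) (u - a ^ 2) + T (X + a) (u - a ^ 2)) / 2 ≤ T X u)
    {S : List ℝ} (hS : ∀ a ∈ S, a ∈ Set.Icc 0 (1 - c)) (hv : sumSq S ≤ v₀) {X : ℝ}
    (hX0 : c - 1 ≤ X) (hX1 : X ≤ c) :
    smallBall (B ++ S) 0 (X + c) ≤ (35 + 35 * T X (sumSq S)) / 128 := by
  have boundary (S : List ℝ) (hv : sumSq S ≤ v₀) (X : ℝ) (hX0 : c - 1 ≤ X) (hX1 : X ≤ c)
      (hX : X ≤ 0 ∨ 2 * c - 1 ≤ X) :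
      smallBall (B ++ S) 0 (X + c) ≤ (35 + 35 * T X (sumSq S)) / 128 := by
    have hvS := sumSq_nonneg S
    have LO (j : ℕ) (hx : X + c ≤ j * c) := smallBall_le_positivePaths B S j hc hB hx
    rw [hBl] at LO
    rcases hX with hX | hX
    · refine (LO 1 (by push_cast; linarith)).trans ?_
      norm_num [positivePaths]
      linarith [h0 X _ hX0 hX1 hvS hv]
    · refine (LO 2 (by push_cast; linarith)).trans ?_
      norm_num [positivePaths]
      linarith [h1 X _ hX hX1 hvS hv]
  induction S generalizing X with
  | nil =>
    by_cases hX : X ≤ 0 ∨ 2 * c - 1 ≤ X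
    · exact boundary _ hv X hX0 hX1 hX
    push Not at hX
    refine (smallBall_le_positivePaths B [] 2 hc hB (by push_cast; linarith)).trans ?_
    rw [hBl, sumSq_nil]
    norm_num [positivePaths]
    linarith [h2 X hX.1.le hX.2.le]
  | cons a S ih =>
    by_cases hX : X ≤ 0 ∨ 2 * c - 1 ≤ X
    · exact boundary _ hv X hX0 hX1 hX
    push Not at hX
    have ha := hS a (by simp)
    have hS' : ∀ d ∈ S, d ∈ Set.Icc 0 (1 - c) := fun d hd => hS d (by simp [hd])
    have hvS := sumSq_nonneg S
    rw [sumSq_cons] at hv ⊢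
    have hv' : sumSq S ≤ v₀ := by nlinarith [sq_nonneg a]
    rw [smallBall_perm List.perm_middle]
    refine (smallBall_cons_le _ _ ha.1).trans ?_
    have h4 := ih hS' hv' (X := X - a) (by linarith [ha.2]) (by linarith [ha.1])
    have h5 := ih hS' hv' (X := X + a) (by linarith [ha.1]) (by linarith [ha.2])
    have h6 := h3 X (a ^ 2 + sumSq S) a hX.1.le hX.2.le ha.1 ha.2 (by linarith) hv
    rw [add_sub_cancel_left] at h6
    rw [show X + c - a = X - a + c by ring, show X + c + a = X + a + c by ring]
    linarith

lemma smallBall_le_half_of_quadratic {B S : List ℝ} {c : ℝ} (hc : 81 / 100 ≤ c) (hc1 : c < 1)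
    (hB : (c :: B).Pairwise (· ≤ ·)) (hBl : B.length = 7)
    (hS : ∀ a ∈ S, a ∈ Set.Icc 0 (1 - c)) (hv : 2 * (1 - c) * (1 + c) ≤ sumSq S) :
    smallBall (B ++ S) 0 1 ≤ 1 / 2 := by
  have hv0 : 0 < sumSq S := lt_of_lt_of_le (mul_pos (by linarith) (by linarith)) hv
  have hcpos : 0 < c := by linarith
  have key := smallBall_le_of_supersolution (by linarith) hB hBl (v₀ := sumSq S)
    (fun X u => (X + (1 - c)) / c + ((X + (1 - c)) * (c - X) + (sumSq S - u)) / sumSq S)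
    ?_ ?_ ?_ ?_ hS le_rfl (X := 1 - c) (by linarith) (by linarith)
  · rw [sub_add_cancel] at key
    refine key.trans ?_
    have h1 : ((1 - c + (1 - c)) * (c - (1 - c)) + (sumSq S - sumSq S)) / sumSq S ≤
        (2 * c - 1) / (1 + c) := by
      rw [div_le_div_iff₀ hv0 (by linarith)]
      nlinarith
    have h2 : (1 - c + (1 - c)) / c + (2 * c - 1) / (1 + c) ≤ 29 / 35 := by
      rw [div_add_div _ _ hcpos.ne' (by linarith), div_le_div_iff₀ (by positivity) (by norm_num)]
      nlinarith
    linarith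
  · intro X u hX0 hX1 hu hu'
    have h1 : 0 ≤ X + (1 - c) := by linarith
    have h2 : 0 ≤ c - X := by linarith
    have h3 : 0 ≤ sumSq S - u := by linarith
    positivity
  · intro X u hX0 hX1 hu hu'
    have h1 : 0 ≤ X + (1 - c) := by linarith
    have h2 : 0 ≤ c - X := by linarith
    have h3 : 0 ≤ sumSq S - u := by linarith
    have h4 : 1 ≤ (X + (1 - c)) / c := (one_le_div hcpos).2 (by linarith)
    have h5 : 0 ≤ ((X + (1 - c)) * (c - X) + (sumSq S - u)) / sumSq S := by positivity
    linarith
  · intro X hX0 hX1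
    have h1 : 0 ≤ X + (1 - c) := by linarith
    have h2 : 0 ≤ c - X := by linarith
    have h4 : 0 ≤ (X + (1 - c)) / c := by positivity
    have h5 : 1 ≤ ((X + (1 - c)) * (c - X) + (sumSq S - 0)) / sumSq S := by
      rw [one_le_div hv0]
      nlinarith
    linarith
  · intro X u a _ _ _ _ _ _
    apply le_of_eq
    field_simp
    ring

lemma smallBall_le_half_of_exponential {B S : List ℝ} {c : ℝ} (hc : 73 / 100 ≤ c)
    (hc1 : c ≤ 81 / 100) (hB : (c :: B).Pairwise (· ≤ ·)) (hBl : B.length = 7)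
    (hS : ∀ a ∈ S, a ∈ Set.Icc 0 (1 - c)) (hv : 2 * (1 - c) * (1 + c) ≤ sumSq S) :
    smallBall (B ++ S) 0 1 ≤ 1 / 2 := by
  have hcpos : 0 < c := by linarith
  have hd : 0 < 1 - c := by linarith
  have hcd : 0 < c * (1 - c) := by positivity
  have key := smallBall_le_of_supersolution (by linarith) hB hBl (v₀ := sumSq S)
    (fun X u => (X + (1 - c)) / c + (X + (1 - c)) * (c - X) * exp (-(4 * u)) / (c * (1 - c)))
    ?_ ?_ ?_ ?_ hS le_rfl (X := 1 - c) (by linarith) (by linarith)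
  · rw [sub_add_cancel] at key
    refine key.trans ?_
    have h1 : exp (-(4 * sumSq S)) ≤ 65 / 1000 := by
      have h2 : exp (-(4 * sumSq S)) ≤ exp (-(275 / 100)) := by
        apply exp_le_exp.2; nlinarith
      refine h2.trans ((exp_neg_le 13 (by decide) (by norm_num)).trans ?_)
      norm_num [Finset.sum_range_succ, Nat.factorial]
    have h2 : (1 - c + (1 - c)) * (c - (1 - c)) * exp (-(4 * sumSq S)) / (c * (1 - c)) ≤
        (1 - c + (1 - c)) * (c - (1 - c)) * (65 / 1000) / (c * (1 - c)) := by
      have : 0 ≤ c - (1 - c) := by linarith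
      gcongr
    have h3 : (1 - c + (1 - c)) / c + (1 - c + (1 - c)) * (c - (1 - c)) * (65 / 1000) /
        (c * (1 - c)) ≤ 29 / 35 := by
      have e : (1 - c + (1 - c)) / c + (1 - c + (1 - c)) * (c - (1 - c)) * (65 / 1000) /
        (c * (1 - c)) = (2 * (1 - c) + 2 * (2 * c - 1) * (65 / 1000)) / c := by
        field_simp; ring
      rw [e, div_le_div_iff₀ hcpos (by norm_num)]
      nlinarith
    linarith
  · intro X u hX0 hX1 hu hu'
    have h1 : 0 ≤ X + (1 - c) := by linarith
    have h2 : 0 ≤ c - X := by linarith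
    positivity
  · intro X u hX0 hX1 hu hu'
    have h1 : 0 ≤ X + (1 - c) := by linarith
    have h2 : 0 ≤ c - X := by linarith
    have h4 : 1 ≤ (X + (1 - c)) / c := (one_le_div hcpos).2 (by linarith)
    have h5 : 0 ≤ (X + (1 - c)) * (c - X) * exp (-(4 * u)) / (c * (1 - c)) := by positivity
    linarith
  · intro X hX0 hX1
    have h1 : 0 ≤ X + (1 - c) := by linarith
    have h4 : 0 ≤ (X + (1 - c)) / c := by positivity
    have h5 : 1 ≤ (X + (1 - c)) * (c - X) * exp (-(4 * 0)) / (c * (1 - c)) := by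
      rw [mul_zero, neg_zero, exp_zero, mul_one, one_le_div hcd]
      nlinarith
    linarith
  · intro X u a hX0 hX1 _ _ _ _
    have h1 : 0 ≤ X + (1 - c) := by linarith
    have h2 : 0 ≤ c - X := by linarith
    set f := (X + (1 - c)) * (c - X) with hf
    have hf0 : 0 ≤ f := by positivity
    have hf4 : f ≤ 1 / 4 := by nlinarith [sq_nonneg (2 * X + 1 - 2 * c)]
    have h3 := add_one_le_exp (-(4 * a ^ 2))
    have h4 : f - a ^ 2 ≤ f * exp (-(4 * a ^ 2)) := by
      have := mul_le_mul_of_nonneg_left h3 hf0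
      nlinarith [sq_nonneg a]
    have h5 : exp (-(4 * u)) = exp (-(4 * a ^ 2)) * exp (-(4 * (u - a ^ 2))) := by
      rw [← exp_add]; congr 1; ring
    rw [h5]
    set E := exp (-(4 * (u - a ^ 2)))
    have hE : 0 < E := exp_pos _
    have h6 : (f - a ^ 2) * E / (c * (1 - c)) ≤
        f * (exp (-(4 * a ^ 2)) * E) / (c * (1 - c)) := by
      rw [← mul_assoc]
      gcongr
    refine le_trans (le_of_eq ?_) (add_le_add_right h6 _)
    rw [hf]
    field_simp
    ring

lemma smallBall_le_half_of_one_le {l : List ℝ} {a : ℝ} (ha : a ∈ l) (h1 : 1 ≤ a) :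
    smallBall l 0 1 ≤ 1 / 2 := by
  rw [smallBall_perm (List.perm_cons_erase ha)]
  refine (smallBall_cons_le _ _ (by linarith)).trans ?_
  rw [smallBall_of_nonpos _ _ (by linarith)]
  linarith [smallBall_le_one (l.erase a) 0 (1 + a)]

lemma smallBall_le_half_of_eight {B S : List ℝ} (hB : ∀ c ∈ B, 1 / 2 ≤ c)
    (hBs : B.Pairwise (· ≤ ·)) (hBl : 8 ≤ B.length) : smallBall (B ++ S) 0 1 ≤ 1 / 2 := by
  rw [← List.take_append_drop 8 B, List.append_assoc]
  have hp : ((1 / 2 : ℝ) :: B.take 8).Pairwise (· ≤ ·) :=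
    List.pairwise_cons.2 ⟨fun c hc => hB c (List.mem_of_mem_take hc), hBs.take⟩
  refine (smallBall_le_positivePaths (B.take 8) _ 2 (by norm_num) hp (by norm_num)).trans ?_
  rw [List.length_take, min_eq_left hBl]
  norm_num [positivePaths]

/-- One jump `a` followed by six larger ones. -/
lemma smallBall_le_half_of_cons_six {a c : ℝ} {B S : List ℝ} (ha : 0 ≤ a)
    (hB : (c :: B).Pairwise (· ≤ ·)) (hBl : B.length = 6) (h1 : 1 - a ≤ c) (h2 : 1 + a ≤ 2 * c) :
    smallBall (a :: (B ++ S)) 0 1 ≤ 1 / 2 := by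
  have hc : 0 ≤ c := by linarith
  refine (smallBall_cons_le _ _ ha).trans ?_
  have h3 := smallBall_le_positivePaths B S 1 hc hB (x := 1 - a) (by push_cast; linarith)
  have h4 := smallBall_le_positivePaths B S 2 hc hB (x := 1 + a) (by push_cast; linarith)
  rw [hBl] at h3 h4
  norm_num [positivePaths] at h3 h4
  linarith

lemma pairwise_head_cons {c : ℝ} {B : List ℝ} (hB : (c :: B).Pairwise (· ≤ ·)) :
    (c :: c :: B).Pairwise (· ≤ ·) := by
  refine List.pairwise_cons.2 ⟨fun d hd => ?_, hB⟩
  rcases List.mem_cons.1 hd with rfl | hd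
  · exact le_rfl
  · exact (List.pairwise_cons.1 hB).1 d hd

lemma smallBall_le_half_of_six {B S : List ℝ} (hB : ∀ c ∈ B, c ∈ Set.Ico (1 / 2) 1)
    (hBs : B.Pairwise (· ≤ ·)) (hBl : B.length = 6) (hS : ∀ a ∈ S, a ∈ Set.Ico 0 (1 / 2))
    (htot : sumSq B + sumSq S = 7) : smallBall (B ++ S) 0 1 ≤ 1 / 2 := by
  have hB' : ∀ c ∈ B, c ∈ Set.Icc (1 / 2) 1 := fun c hc => ⟨(hB c hc).1, (hB c hc).2.le⟩
  have hsum (B : List ℝ) (hB : ∀ c ∈ B, c ∈ Set.Icc (1 / 2) 1) : sumSq B ≤ B.length :=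
    sumSq_le_length fun c hc => ⟨by linarith [(hB c hc).1], (hB c hc).2⟩
  by_cases hthird : ∀ a ∈ S, a ≤ 1 / 3
  · have := hsum B hB'
    rw [hBl] at this
    push_cast at this
    exact smallBall_le_half_of_third hB' hBs (by omega) (fun a ha => ⟨(hS a ha).1, hthird a ha⟩)
      (by linarith) htot
  · push Not at hthird
    obtain ⟨a, haS, ha⟩ := hthird
    have ha' := hS a haS
    rcases B with _ | ⟨c, B⟩
    · simp at hBl
    rcases le_total (3 / 4) c with hc | hc
    · have hp : (c :: B ++ S).Perm (a :: (c :: B ++ S.erase a)) :=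
        ((List.perm_cons_erase haS).append_left _).trans List.perm_middle
      rw [smallBall_perm hp]
      exact smallBall_le_half_of_cons_six ha'.1 (pairwise_head_cons hBs) hBl (by linarith)
        (by linarith [ha'.2])
    · have h1 := hsum B fun d hd => hB' d (by simp [hd])
      have h2 : B.length = 5 := by simpa using hBl
      have h3 := (hB c (by simp)).1
      rw [h2] at h1
      push_cast at h1
      refine smallBall_le_half_of_half hB' hBs (by omega)
        (fun a ha => ⟨(hS a ha).1, (hS a ha).2.le⟩) ?_ htot
      rw [sumSq_cons] at htot
      nlinarith

lemma smallBall_le_half_of_seven {B S : List ℝ} (hB : ∀ c ∈ B, c ∈ Set.Ico (1 / 2) 1)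
    (hBs : B.Pairwise (· ≤ ·)) (hBl : B.length = 7) (hS : ∀ a ∈ S, a ∈ Set.Ico 0 (1 / 2))
    (htot : sumSq B + sumSq S = 7) : smallBall (B ++ S) 0 1 ≤ 1 / 2 := by
  have hB' : ∀ c ∈ B, c ∈ Set.Icc (1 / 2) 1 := fun c hc => ⟨(hB c hc).1, (hB c hc).2.le⟩
  obtain ⟨c, d, f, B, rfl⟩ : ∃ c d f B', B = c :: d :: f :: B' := by
    rcases B with _ | ⟨c, _ | ⟨d, _ | ⟨f, B⟩⟩⟩ <;> simp at hBl ⊢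
  have hBs₁ := (List.pairwise_cons.1 hBs).2
  have hBs₂ := (List.pairwise_cons.1 hBs₁).2
  have hc := hB c (by simp)
  have hd := hB d (by simp)
  have hf := hB f (by simp)
  have hcd : c ≤ d := (List.pairwise_cons.1 hBs).1 d (by simp)
  have hdf : d ≤ f := (List.pairwise_cons.1 hBs₁).1 f (by simp)
  have hl : B.length = 4 := by simpa using hBl
  by_cases hlarge : ∃ a ∈ S, 1 - c < a
  · obtain ⟨a, haS, ha⟩ := hlarge
    have ha' := hS a haS
    have hp : (c :: d :: f :: B ++ S).Perm (a :: (c :: d :: f :: B ++ S.erase a)) :=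
      ((List.perm_cons_erase haS).append_left _).trans List.perm_middle
    rw [smallBall_perm hp]
    refine (smallBall_cons_le _ _ ha'.1).trans ?_
    have hs := pairwise_head_cons hBs
    have hc0 : 0 ≤ c := by linarith [hc.1]
    have h3 := smallBall_le_positivePaths _ (S.erase a) 1 hc0 hs (x := 1 - a)
      (by push_cast; linarith)
    have h4 := smallBall_le_positivePaths _ (S.erase a) 3 hc0 hs (x := 1 + a)
      (by push_cast; linarith [hc.1, ha'.2])
    rw [hBl] at h3 h4
    norm_num [positivePaths] at h3 h4
    simp only [List.cons_append]
    linarith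
  push Not at hlarge
  by_cases h2d : 1 + c ≤ 2 * d
  · exact smallBall_le_half_of_cons_six (by linarith [hc.1]) (pairwise_head_cons hBs₁)
      (by simpa using hBl) (by linarith [hc.1]) h2d
  push Not at h2d
  by_cases hf1 : 1 - (d - c) ≤ f
  · have h1 := smallBall_cons_le (d :: f :: B ++ S) 1 (a := c) (by linarith [hc.1])
    have h2 := smallBall_cons_le (f :: B ++ S) (1 - c) (a := d) (by linarith [hd.1])
    have h3 := smallBall_cons_le (f :: B ++ S) (1 + c) (a := d) (by linarith [hd.1])
    rw [smallBall_of_nonpos _ _ (show 1 - c - d ≤ 0 by linarith [hc.1, hd.1])] at h2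
    have h4 := smallBall_le_one (f :: B ++ S) 0 (1 + c + d)
    have hs := pairwise_head_cons hBs₂
    have hf0 : 0 ≤ f := by linarith [hf.1]
    have h5 := smallBall_le_positivePaths _ S 2 hf0 hs (x := 1 - c + d)
      (by push_cast; linarith [hc.1])
    have h6 := smallBall_le_positivePaths _ S 1 hf0 hs (x := 1 + c - d)
      (by push_cast; linarith)
    rw [List.length_cons, hl] at h5 h6
    norm_num [positivePaths] at h5 h6
    simp only [List.cons_append] at *
    linarith
  push Not at hf1
  have hv : 2 * (1 - c) * (1 + c) ≤ sumSq S := by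
    have h1 : sumSq B ≤ B.length :=
      sumSq_le_length fun b hb => by
        have := hB b (by simp [hb])
        exact ⟨by linarith [this.1], this.2.le⟩
    rw [hl] at h1
    push_cast at h1
    simp only [sumSq_cons] at htot
    have h2 : f ^ 2 ≤ (1 - (d - c)) ^ 2 := by
      have := hf.1
      gcongr
    nlinarith [mul_nonneg (sub_nonneg.2 hcd) (sub_nonneg.2 h2d.le)]
  have hS' : ∀ a ∈ S, a ∈ Set.Icc 0 (1 - c) := fun a ha => ⟨(hS a ha).1, hlarge a ha⟩
  have hS'' (s : ℝ) (hs : 1 - c ≤ s) : ∀ a ∈ S, a ∈ Set.Icc 0 s :=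
    fun a ha => ⟨(hS a ha).1, (hlarge a ha).trans hs⟩
  rcases le_total (81 / 100) c with h81 | h81
  · exact smallBall_le_half_of_quadratic h81 hc.2 (pairwise_head_cons hBs) hBl hS' hv
  rcases le_total (73 / 100) c with h73 | h73
  · exact smallBall_le_half_of_exponential h73 h81 (pairwise_head_cons hBs) hBl hS' hv
  rcases le_total (2 / 3) c with h67 | h67
  · exact smallBall_le_half_of_third hB' hBs hBl.le (hS'' _ (by linarith)) (by nlinarith) htot
  rcases le_total (14 / 25) c with h56 | h56
  · exact smallBall_le_half_of_eleven hB' hBs hBl.le (hS'' _ (by linarith)) (by nlinarith) htot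
  · exact smallBall_le_half_of_half hB' hBs hBl.le (hS'' _ (by linarith [hc.1]))
      (by nlinarith [hc.1]) htot

theorem smallBall_le_half {l : List ℝ} (hl : ∀ a ∈ l, 0 ≤ a) (hsum : sumSq l = 7) :
    smallBall l 0 1 ≤ 1 / 2 := by
  by_cases h1 : ∃ a ∈ l, 1 ≤ a
  · obtain ⟨a, ha, h1⟩ := h1
    exact smallBall_le_half_of_one_le ha h1
  push Not at h1
  set m := l.insertionSort (· ≤ ·)
  set B := m.filter (1 / 2 ≤ ·)
  set S := m.filter fun a => !decide (1 / 2 ≤ a)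
  have hp : l.Perm (B ++ S) :=
    (List.perm_insertionSort (· ≤ ·) l).symm.trans (List.filter_append_perm _ _).symm
  have hm : ∀ a, a ∈ m ↔ a ∈ l := fun a => (List.perm_insertionSort (· ≤ ·) l).mem_iff
  have hB : ∀ c ∈ B, c ∈ Set.Ico (1 / 2) 1 := fun c hc => by
    have := List.mem_filter.1 hc
    exact ⟨by simpa using this.2, h1 c ((hm c).1 this.1)⟩
  have hS : ∀ c ∈ S, c ∈ Set.Ico 0 (1 / 2) := fun c hc => by
    have := List.mem_filter.1 hc
    exact ⟨hl c ((hm c).1 this.1), by simpa using this.2⟩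
  have hBs : B.Pairwise (· ≤ ·) := (List.pairwise_insertionSort (· ≤ ·) l).filter _
  rw [sumSq_perm hp, sumSq_append] at hsum
  rw [smallBall_perm hp]
  obtain h | h | h | h : B.length ≤ 5 ∨ B.length = 6 ∨ B.length = 7 ∨ 8 ≤ B.length := by omega
  · have hB' : ∀ c ∈ B, c ∈ Set.Icc (1 / 2) 1 := fun c hc => ⟨(hB c hc).1, (hB c hc).2.le⟩
    have h2 := sumSq_le_length fun c hc => ⟨by linarith [(hB' c hc).1], (hB' c hc).2⟩
    have h3 : (B.length : ℝ) ≤ 5 := by exact_mod_cast h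
    exact smallBall_le_half_of_half hB' hBs (by omega)
      (fun a ha => ⟨(hS a ha).1, (hS a ha).2.le⟩) (by linarith) hsum
  · exact smallBall_le_half_of_six hB hBs h hS hsum
  · exact smallBall_le_half_of_seven hB hBs h hS hsum
  · exact smallBall_le_half_of_eight (fun c hc => (hB c hc).1) hBs h

open Classical in
lemma radProb_add_radProb_not {ι : Type*} [Fintype ι] (a : ι → ℝ) (p : ℝ → Prop) :
    radProb a p + radProb a (fun x => ¬ p x) = 1 := by
  unfold radProb
  rw [← add_div, div_eq_one_iff_eq (by positivity)]
  simp only [Set.coe_ofPred, Nat.card_eq_fintype_card, Fintype.card_subtype]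
  rw [← Nat.cast_add, Finset.card_filter_add_card_filter_not, Finset.card_univ]
  simp

lemma radProb_abs_lt {n : ℕ} (a : Fin n → ℝ) (x : ℝ) :
    radProb a (fun t => |t| < x) = smallBall (List.ofFn a) 0 x := by
  classical
  rw [smallBall_ofFn, radProb, Fintype.card_fin, Finset.sum_boole]
  simp [Nat.card_eq_fintype_card, Fintype.card_subtype]

lemma radProb_abs_lt_const_mul {n : ℕ} (a : Fin n → ℝ) {c : ℝ} (hc : 0 < c) (x : ℝ) :
    radProb (fun i => c * a i) (fun t => |t| < c * x) = radProb a (fun t => |t| < x) := by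
  unfold radProb
  simp only [mul_assoc, ← Finset.mul_sum, abs_mul, abs_of_pos hc, mul_lt_mul_iff_right₀ hc]

theorem abs_rademacher_ge_inv_sqrt7 (n : ℕ) (hn : 0 < n) (a : Fin n → ℝ)
    (hnorm : ∑ i, (a i) ^ 2 = 1) :
    radProb a (fun x => |x| ≥ 1 / Real.sqrt 7) ≥ 1 / 2 := by
  have h7 : 0 < √(7 : ℝ) := by positivity
  have hsum : sumSq ((List.ofFn fun i => √7 * a i).map fun t => |t|) = 7 := by
    rw [sumSq, List.map_map, List.map_ofFn, List.sum_ofFn]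
    simp [mul_pow, ← Finset.mul_sum, hnorm]
  have hsmall := smallBall_le_half (fun t ht => by
    obtain ⟨u, _, rfl⟩ := List.mem_map.1 ht
    exact abs_nonneg u) hsum
  have hscale := radProb_abs_lt_const_mul a h7 (1 / √7)
  rw [mul_one_div_cancel h7.ne'] at hscale
  rw [smallBall_map_abs, ← radProb_abs_lt, hscale] at hsmall
  have := radProb_add_radProb_not a (fun x => |x| ≥ 1 / √7)
  simp only [ge_iff_le, not_le] at this ⊢
  linarith
end

section
/- For every normalized finite Rademacher sum X = Σ_{i=1}^n a_i ε_i, one has P(|X| ≥ 1/√3) ≥ 3/8. -/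
/-- `radExcess l s` is `P(|s + X| < 1) - P(|s + X| ≥ 1)`, where `X` is the Rademacher sum whose
weights are the entries of `l`. -/
noncomputable def radExcess : List ℝ → ℝ → ℝ
  | [], s => if |s| < 1 then 1 else -1
  | a :: l, s => (radExcess l (s + a) + radExcess l (s - a)) / 2

/-- The sum of the squares of the entries of a list. -/
def sqSum (l : List ℝ) : ℝ := (l.map (· ^ 2)).sum

@[simp] lemma sqSum_nil : sqSum [] = 0 := by simp [sqSum]

@[simp] lemma sqSum_cons (a : ℝ) (l : List ℝ) : sqSum (a :: l) = a ^ 2 + sqSum l := by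
  simp [sqSum]

@[simp] lemma sqSum_append (l m : List ℝ) : sqSum (l ++ m) = sqSum l + sqSum m := by
  simp [sqSum]

lemma sqSum_nonneg (l : List ℝ) : 0 ≤ sqSum l := by
  induction l with
  | nil => simp
  | cons a l ih => rw [sqSum_cons]; positivity

lemma sqSum_perm {l m : List ℝ} (h : l.Perm m) : sqSum l = sqSum m :=
  (h.map _).sum_eq

lemma radExcess_cons (a : ℝ) (l : List ℝ) (s : ℝ) :
    radExcess (a :: l) s = (radExcess l (s + a) + radExcess l (s - a)) / 2 := rfl

lemma radExcess_le_one (l : List ℝ) (s : ℝ) : radExcess l s ≤ 1 := by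
  induction l generalizing s with
  | nil => unfold radExcess; split_ifs <;> norm_num
  | cons a l ih => rw [radExcess_cons]; linarith [ih (s + a), ih (s - a)]

lemma radExcess_neg (l : List ℝ) (s : ℝ) : radExcess l (-s) = radExcess l s := by
  induction l generalizing s with
  | nil => simp [radExcess]
  | cons a l ih =>
    rw [radExcess_cons, radExcess_cons, ← ih (s + a), ← ih (s - a), add_comm]
    ring_nf

lemma radExcess_abs (l : List ℝ) (s : ℝ) : radExcess l |s| = radExcess l s := by
  rcases abs_choice s with h | h <;> rw [h]
  exact radExcess_neg l s

lemma radExcess_perm {l m : List ℝ} (h : l.Perm m) (s : ℝ) : radExcess l s = radExcess m s := by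
  induction h generalizing s with
  | nil => rfl
  | cons a _ ih => rw [radExcess_cons, radExcess_cons, ih, ih]
  | swap a b l =>
    simp only [radExcess_cons, add_right_comm s b a, sub_add_eq_add_sub, sub_right_comm s b a]
    ring_nf
  | trans _ _ ih₁ ih₂ => rw [ih₁, ih₂]

lemma radExcess_map_abs (l : List ℝ) (s : ℝ) : radExcess (l.map abs) s = radExcess l s := by
  induction l generalizing s with
  | nil => rfl
  | cons a l ih =>
    rw [List.map_cons, radExcess_cons, radExcess_cons, ih, ih]
    rcases abs_choice a with h | h <;> rw [h]
    rw [sub_neg_eq_add, ← sub_eq_add_neg, add_comm]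

lemma radExcess_add_nonpos (l : List ℝ) {x y : ℝ} (h : y + 2 ≤ x) :
    radExcess l x + radExcess l y ≤ 0 := by
  induction l generalizing x y with
  | nil =>
    unfold radExcess
    split_ifs with hx hy hy <;> norm_num
    rw [abs_lt] at hx hy
    linarith
  | cons a l ih =>
    rw [radExcess_cons, radExcess_cons]
    linarith [ih (x := x + a) (y := y + a) (by linarith),
      ih (x := x - a) (y := y - a) (by linarith)]

lemma radExcess_nonpos (l : List ℝ) {s : ℝ} (h : 1 ≤ |s|) : radExcess l s ≤ 0 := by
  have := radExcess_add_nonpos l (x := |s|) (y := -|s|) (by linarith)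
  rw [radExcess_neg, radExcess_abs] at this
  linarith

lemma radExcess_cons_zero (a : ℝ) (l : List ℝ) : radExcess (a :: l) 0 = radExcess l a := by
  rw [radExcess_cons, zero_add, zero_sub, radExcess_neg]
  ring

lemma radExcess_cons_le_half {x u : ℝ} (h : 1 ≤ |u| + x) (l : List ℝ) :
    radExcess (x :: l) u ≤ 1 / 2 := by
  rw [← radExcess_abs, radExcess_cons]
  have := radExcess_nonpos l (s := |u| + x) (h.trans (le_abs_self _))
  linarith [radExcess_le_one l (|u| - x)]

lemma radExcess_pair_le {x y : ℝ} (h : 1 ≤ x + y) (l : List ℝ) :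
    radExcess (x :: y :: l) 0 ≤ radExcess l (x - y) / 2 := by
  rw [radExcess_cons_zero, radExcess_cons]
  linarith [radExcess_nonpos l (h.trans (le_abs_self _))]

lemma radExcess_triple_le {x y z : ℝ} (h : 1 ≤ x + y) (h' : 1 ≤ |x - y| + z) (l : List ℝ) :
    radExcess (x :: y :: z :: l) 0 ≤ 1 / 4 := by
  linarith [radExcess_pair_le h (z :: l), radExcess_cons_le_half h' l]

lemma sum_sign_eq_radExcess (n : ℕ) (b : Fin n → ℝ) (s : ℝ) :
    ∑ ε : Fin n → Bool,
      (if |s + ∑ i, b i * (if ε i then (1 : ℝ) else -1)| < 1 then (1 : ℝ) else -1) =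
      2 ^ n * radExcess (List.ofFn b) s := by
  induction n generalizing s with
  | zero => simp [radExcess]
  | succ n ih =>
    rw [← Equiv.sum_comp (Fin.consEquiv fun _ => Bool), Fintype.sum_prod_type, List.ofFn_succ,
      radExcess_cons]
    simp only [Fintype.sum_bool, Fin.sum_univ_succ, Fin.consEquiv_apply, Fin.cons_zero,
      Fin.cons_succ, if_true, Bool.false_eq_true, if_false, ← add_assoc, ih]
    ring_nf

lemma radProb_one_le_abs (n : ℕ) (b : Fin n → ℝ) :
    radProb b (fun x => 1 ≤ |x|) = (1 - radExcess (List.ofFn b) 0) / 2 := by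
  have h := sum_sign_eq_radExcess n b 0
  have hc : (Nat.card {ε : Fin n → Bool | 1 ≤ |∑ i, b i * (if ε i then (1 : ℝ) else -1)|} : ℝ) =
      ∑ ε : Fin n → Bool, (1 - (if |0 + ∑ i, b i * (if ε i then (1 : ℝ) else -1)| < 1
        then (1 : ℝ) else -1)) / 2 := by
    rw [Nat.card_eq_fintype_card, Fintype.card_ofFinset, ← Finset.sum_boole]
    refine Finset.sum_congr rfl fun ε _ => ?_
    simp only [zero_add, Set.mem_ofPred_eq]
    split_ifs <;> linarith
  rw [radProb, hc, ← Finset.sum_div, Finset.sum_sub_distrib, h]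
  simp
  field_simp

/-- It suffices to bound the excess of descending lists of weights in `[0, ∞)`. -/
lemma three_eighths_le_radProb
    (H : ∀ l : List ℝ, l.Pairwise (· ≥ ·) → (∀ a ∈ l, 0 ≤ a) → sqSum l = 3 →
      radExcess l 0 ≤ 1 / 4)
    (n : ℕ) (a : Fin n → ℝ) (hnorm : ∑ i, (a i) ^ 2 = 1) :
    3 / 8 ≤ radProb a (fun x => 1 / Real.sqrt 3 ≤ |x|) := by
  have h3 : (0 : ℝ) < √3 := by positivity
  have hb : radProb a (fun x => 1 / √3 ≤ |x|) = radProb (fun i => √3 * a i) (fun x => 1 ≤ |x|) := by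
    simp only [radProb, mul_assoc, ← Finset.mul_sum, abs_mul, abs_of_pos h3, div_le_iff₀' h3]
  set m := (List.ofFn fun i => √3 * a i).map abs with hm
  have hp := m.perm_insertionSort (· ≥ ·)
  have hs : sqSum m = 3 := by
    rw [hm, sqSum, List.map_map, List.map_ofFn, List.sum_ofFn]
    simp [mul_pow, ← Finset.mul_sum, hnorm]
  have := H (m.insertionSort (· ≥ ·)) (m.pairwise_insertionSort _)
    (fun x hx => by
      obtain ⟨y, -, rfl⟩ := List.mem_map.1 (hp.mem_iff.1 hx)
      exact abs_nonneg y) (by rw [sqSum_perm hp, hs])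
  rw [radExcess_perm hp, hm, radExcess_map_abs] at this
  rw [hb, radProb_one_le_abs]
  linarith

open Real in
lemma cos_le_one_sub_add {x : ℝ} (h₀ : 0 ≤ x) (h₂ : x ≤ 2) :
    cos x ≤ 1 - x ^ 2 / 2 + x ^ 4 / 24 := by
  have h := sin_ge_sub_cube (x := x / 2) (by linarith)
  have hc : cos x = 1 - 2 * sin (x / 2) ^ 2 := by
    rw [sin_sq, show x = 2 * (x / 2) by ring, cos_two_mul]
    ring_nf
  have h₀' : 0 ≤ x / 2 - (x / 2) ^ 3 / 6 := by nlinarith [mul_nonneg h₀ h₀]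
  have := pow_le_pow_left₀ h₀' h 2
  nlinarith [sq_nonneg (x ^ 3)]

open Real in
lemma cos_le_exp_neg_sq_div_two {x : ℝ} (h₀ : 0 ≤ x) (h : x ≤ π / 2) :
    cos x ≤ exp (-(x ^ 2 / 2)) := by
  have hπ := pi_lt_d4
  have h₁ := cos_le_one_sub_add h₀ (by linarith)
  have h₂ : (1 - x ^ 2 / 8) ^ 4 ≤ exp (-(x ^ 2 / 2)) := by
    rw [show -(x ^ 2 / 2) = (4 : ℕ) * (-(x ^ 2 / 8)) by push_cast; ring, exp_nat_mul]
    have := add_one_le_exp (-(x ^ 2 / 8))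
    exact pow_le_pow_left₀ (by nlinarith) (by linarith) 4
  have h₃ : x ^ 2 ≤ 5 / 2 := by nlinarith
  refine (h₁.trans ?_).trans h₂
  nlinarith [sq_nonneg (x ^ 2), mul_nonneg (sq_nonneg (x ^ 2)) (sub_nonneg.2 h₃),
    sq_nonneg (x ^ 4)]

open Real in
lemma exp_neg_le_of_one_le_mul {t q : ℝ} (ht : 0 ≤ t)
    (h : 1 ≤ q * (1 + t + t ^ 2 / 2 + t ^ 3 / 6 + t ^ 4 / 24 + t ^ 5 / 120 + t ^ 6 / 720)) :
    exp (-t) ≤ q := by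
  have h₁ := sum_le_exp_of_nonneg ht 7
  simp only [Finset.sum_range_succ, Finset.sum_range_zero, Nat.factorial] at h₁
  norm_num at h₁
  have hq : 0 < q := by
    by_contra hq
    have : 0 ≤ 1 + t + t ^ 2 / 2 + t ^ 3 / 6 + t ^ 4 / 24 + t ^ 5 / 120 + t ^ 6 / 720 := by
      positivity
    nlinarith
  rw [exp_neg, inv_le_iff_one_le_mul₀ (exp_pos t)]
  exact h.trans (mul_le_mul_of_nonneg_left h₁ hq.le)

open Real in
lemma one_sub_le_cos (θ : ℝ) {x y : ℝ} (h₀ : 0 ≤ x) (h : x ≤ y) :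
    1 - θ ^ 2 / 2 * y ^ 2 ≤ cos (θ * x) := by
  refine le_trans ?_ one_sub_sq_div_two_le_cos
  nlinarith [mul_le_mul_of_nonneg_left (pow_le_pow_left₀ h₀ h 2) (sq_nonneg θ)]

open Real in
lemma exp_neg_mul_le_mul_cos {c θ b m q k V : ℝ} (hb : b ≤ 1) (hk : 0 ≤ k)
    (hq : exp (-(c * (V - m))) ≤ q) (hm : 0 < 1 - c * (b ^ 2 - m))
    (h : q ≤ k * (1 - c * (b ^ 2 - m)) * (1 - θ ^ 2 / 2 * (1 - b) ^ 2)) :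
    exp (-(c * (V - b ^ 2))) ≤ k * cos (θ * (1 - b)) := by
  have h₁ := one_sub_le_cos θ (sub_nonneg.2 hb) le_rfl
  have h₂ : exp (-(c * (V - b ^ 2))) * (1 - c * (b ^ 2 - m)) ≤ exp (-(c * (V - m))) := by
    have := add_one_le_exp (-(c * (b ^ 2 - m)))
    calc _ ≤ exp (-(c * (V - b ^ 2))) * exp (-(c * (b ^ 2 - m))) := by
          gcongr; linarith
      _ = _ := by rw [← exp_add]; ring_nf
  have h₃ : k * (1 - c * (b ^ 2 - m)) * (1 - θ ^ 2 / 2 * (1 - b) ^ 2) ≤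
      k * (1 - c * (b ^ 2 - m)) * cos (θ * (1 - b)) :=
    mul_le_mul_of_nonneg_left h₁ (by positivity)
  refine le_of_mul_le_mul_right (a := 1 - c * (b ^ 2 - m)) ?_ hm
  linarith

open Real in
/-- Averaging over one sign shrinks the potential `cos (θ * s) * exp (-(c * v))`. -/
lemma radExcess_append_le_cos_mul_exp {θ c ρ δ C : ℝ} {B : List ℝ} (hθ : 0 ≤ θ) (hC : 0 ≤ C)
    (hδ : 0 ≤ δ) (hθρ : θ * (ρ + δ) ≤ π / 2) (l : List ℝ)
    (hl : ∀ a ∈ l, 0 ≤ a ∧ a ≤ δ ∧ cos (θ * a) ≤ exp (-(c * a ^ 2)))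
    (hB : ∀ s, |s| < ρ → radExcess B s ≤ C * cos (θ * s))
    (hout : ∀ l', l' <:+ l → ∀ t, ρ ≤ |t| → |t| < ρ + δ →
      radExcess (l' ++ B) t ≤ C * cos (θ * t) * exp (-(c * sqSum l')))
    {s : ℝ} (hs : |s| < ρ) :
    radExcess (l ++ B) s ≤ C * cos (θ * s) * exp (-(c * sqSum l)) := by
  induction l generalizing s with
  | nil => simpa using hB s hs
  | cons a l ih =>
    obtain ⟨ha₀, haδ, hcos⟩ := hl a (by simp)
    have key : ∀ t, |t| < ρ + δ →
        radExcess (l ++ B) t ≤ C * cos (θ * t) * exp (-(c * sqSum l)) := by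
      intro t ht
      rcases lt_or_ge |t| ρ with h | h
      · exact ih (fun x hx => hl x (by simp [hx]))
          (fun l' h' => hout l' (h'.trans (List.suffix_cons a l))) h
      · exact hout l (List.suffix_cons a l) t h ht
    have hp := key (s + a) (by rw [abs_lt] at hs ⊢; constructor <;> linarith)
    have hm := key (s - a) (by rw [abs_lt] at hs ⊢; constructor <;> linarith)
    have hs0 : 0 ≤ cos (θ * s) := by
      rw [← cos_abs, abs_mul, abs_of_nonneg hθ]
      apply cos_nonneg_of_neg_pi_div_two_le_of_le
      · have := mul_nonneg hθ (abs_nonneg s)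
        linarith [pi_pos]
      · nlinarith
    rw [List.cons_append, radExcess_cons, sqSum_cons]
    calc _ ≤ C * cos (θ * s) * exp (-(c * sqSum l)) * cos (θ * a) := by
          rw [mul_add, mul_sub] at *
          rw [cos_add] at hp
          rw [cos_sub] at hm
          linarith
      _ ≤ C * cos (θ * s) * exp (-(c * sqSum l)) * exp (-(c * a ^ 2)) := by gcongr
      _ = _ := by rw [mul_assoc _ (exp _), ← exp_add]; ring_nf

/-- A quadratic bound that exploits that the partial sums leave `(-ρ, ρ)` quickly. -/
lemma radExcess_append_le_quadratic {m ρ δ : ℝ} {B : List ℝ} (hm : m ≤ 1) (hρ : 0 ≤ ρ)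
    (hδ : 0 < δ) (l : List ℝ) (hl : ∀ a ∈ l, 0 ≤ a ∧ a ≤ δ)
    (hout : ∀ l', l' <:+ l → ∀ t, ρ ≤ |t| → |t| < ρ + δ → radExcess (l' ++ B) t ≤ m)
    {s : ℝ} (hs : |s| < ρ) :
    radExcess (l ++ B) s ≤
      m + (1 - m) * (((ρ + δ) ^ 2 - s ^ 2) / (sqSum l + (ρ + δ) ^ 2 - ρ ^ 2)) := by
  have hc : 0 < (ρ + δ) ^ 2 - ρ ^ 2 := by nlinarith
  have big : ∀ l : List ℝ, ∀ s, sqSum l + s ^ 2 ≤ ρ ^ 2 → radExcess (l ++ B) s ≤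
      m + (1 - m) * (((ρ + δ) ^ 2 - s ^ 2) / (sqSum l + (ρ + δ) ^ 2 - ρ ^ 2)) := by
    intro l s h
    have : 1 ≤ ((ρ + δ) ^ 2 - s ^ 2) / (sqSum l + (ρ + δ) ^ 2 - ρ ^ 2) := by
      rw [le_div_iff₀ (by linarith [sqSum_nonneg l])]
      linarith
    nlinarith [radExcess_le_one (l ++ B) s]
  induction l generalizing s with
  | nil => exact big [] s (by simpa using (sq_lt_sq' (abs_lt.1 hs).1 (abs_lt.1 hs).2).le)
  | cons a l ih =>
    obtain ⟨ha₀, haδ⟩ := hl a (by simp)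
    rcases le_or_gt (sqSum (a :: l) + s ^ 2) (ρ ^ 2) with h | h
    · exact big _ _ h
    have hD : 0 < sqSum l + (ρ + δ) ^ 2 - ρ ^ 2 := by linarith [sqSum_nonneg l]
    have key : ∀ t, |t| < ρ + δ → radExcess (l ++ B) t ≤
        m + (1 - m) * (((ρ + δ) ^ 2 - t ^ 2) / (sqSum l + (ρ + δ) ^ 2 - ρ ^ 2)) := by
      intro t ht
      rcases lt_or_ge |t| ρ with h | h
      · exact ih (fun x hx => hl x (by simp [hx]))
          (fun l' h' => hout l' (h'.trans (List.suffix_cons a l))) h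
      · have h₁ := hout l (List.suffix_cons a l) t h ht
        have h₂ : 0 ≤ ((ρ + δ) ^ 2 - t ^ 2) / (sqSum l + (ρ + δ) ^ 2 - ρ ^ 2) :=
          div_nonneg (by linarith [sq_lt_sq' (abs_lt.1 ht).1 (abs_lt.1 ht).2]) hD.le
        nlinarith
    have hp := key (s + a) (by rw [abs_lt] at hs ⊢; constructor <;> linarith)
    have hm' := key (s - a) (by rw [abs_lt] at hs ⊢; constructor <;> linarith)
    rw [sqSum_cons] at h ⊢
    rw [List.cons_append, radExcess_cons]
    have hav : (((ρ + δ) ^ 2 - (s + a) ^ 2) / (sqSum l + (ρ + δ) ^ 2 - ρ ^ 2) +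
        ((ρ + δ) ^ 2 - (s - a) ^ 2) / (sqSum l + (ρ + δ) ^ 2 - ρ ^ 2)) / 2 ≤
        ((ρ + δ) ^ 2 - s ^ 2) / (a ^ 2 + sqSum l + (ρ + δ) ^ 2 - ρ ^ 2) := by
      rw [← add_div, div_div, div_le_div_iff₀ (by linarith) (by nlinarith)]
      nlinarith [mul_nonneg (sq_nonneg a) (sub_nonneg.2 h.le)]
    nlinarith

open Real in
lemma radExcess_append_singleton_le {θ δ b s : ℝ} (hθ : 0 < θ) (hδ : 0 < δ)
    (hθδ : θ * (1 + δ) ≤ π / 2) (l : List ℝ) (hl : ∀ a ∈ l, 0 ≤ a ∧ a ≤ δ)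
    (hb₀ : 0 ≤ b) (hb₁ : b ≤ 1) (hs : |s| < 1) :
    radExcess (l ++ [b]) s ≤ cos (θ * s) * exp (-(θ ^ 2 / 2 * sqSum l)) / cos (θ * (1 - b)) := by
  have hb : 0 < cos (θ * (1 - b)) :=
    cos_pos_of_mem_Ioo ⟨by nlinarith [pi_pos], by nlinarith⟩
  have hnn : ∀ t, |t| < 1 + δ → 0 ≤ cos (θ * t) := by
    intro t ht
    rw [← cos_abs, abs_mul, abs_of_pos hθ]
    exact cos_nonneg_of_neg_pi_div_two_le_of_le
      (by linarith [pi_pos, mul_nonneg hθ.le (abs_nonneg t)]) (by nlinarith)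
  have := radExcess_append_le_cos_mul_exp (θ := θ) (c := θ ^ 2 / 2) (ρ := 1) (δ := δ)
    (C := (cos (θ * (1 - b)))⁻¹) (B := [b]) hθ.le (inv_nonneg.2 hb.le) hδ.le hθδ l ?_ ?_ ?_ hs
  · rw [div_eq_inv_mul, ← mul_assoc]
    exact this
  · intro a ha
    obtain ⟨h₀, h₁⟩ := hl a ha
    refine ⟨h₀, h₁, (cos_le_exp_neg_sq_div_two (by positivity) (by nlinarith)).trans_eq ?_⟩
    ring_nf
  · intro t ht
    rw [← div_eq_inv_mul]
    rcases le_or_gt (1 - b) |t| with h | h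
    · refine le_trans ?_ (div_nonneg (hnn t (by linarith)) hb.le)
      have h₁ : radExcess [] (|t| + b) = -1 := by
        rw [radExcess, if_neg]
        rw [abs_of_nonneg (by positivity)]
        linarith
      rw [← radExcess_abs, radExcess_cons, h₁]
      linarith [radExcess_le_one [] (|t| - b)]
    · refine (radExcess_le_one _ _).trans ((one_le_div hb).2 ?_)
      rw [← cos_abs (θ * t), abs_mul, abs_of_pos hθ]
      exact cos_le_cos_of_nonneg_of_le_pi (by positivity) (by nlinarith [pi_pos])
        (by gcongr)
  · intro l' _ t h₁ h₂
    refine (radExcess_nonpos _ h₁).trans ?_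
    have := hnn t h₂
    positivity

lemma exists_append_sqSum {b w : ℝ} (l : List ℝ) (hl : ∀ a ∈ l, 0 ≤ a ∧ a ≤ b)
    (hw₀ : 0 ≤ w) (hw : w ≤ sqSum l) :
    ∃ l₁ l₂, l = l₁ ++ l₂ ∧ w ≤ sqSum l₂ ∧ sqSum l₂ ≤ w + b ^ 2 := by
  induction l with
  | nil => exact ⟨[], [], rfl, hw, by rw [sqSum_nil]; positivity⟩
  | cons a l ih =>
    rcases le_or_gt w (sqSum l) with h | h
    · obtain ⟨l₁, l₂, rfl, h₂⟩ := ih (fun x hx => hl x (by simp [hx])) h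
      exact ⟨a :: l₁, l₂, rfl, h₂⟩
    · obtain ⟨h₀, h₁⟩ := hl a (by simp)
      refine ⟨[], a :: l, rfl, hw, ?_⟩
      rw [sqSum_cons]
      nlinarith

open Real in
lemma cos_mul_le_exp_neg {θ a : ℝ} (hθ : 0 ≤ θ) (ha : 0 ≤ a) (h : θ * a ≤ π / 2) :
    cos (θ * a) ≤ exp (-(θ ^ 2 / 2 * a ^ 2)) :=
  (cos_le_exp_neg_sq_div_two (by positivity) h).trans_eq (by ring_nf)

open Real in
lemma radExcess_cons_cons_le_quarter (θ δ m q : ℝ) {x y : ℝ} {t : List ℝ} (hθ : 0 < θ)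
    (hδ : 0 < δ) (hθδ : θ * (1 + δ) ≤ 1.5707) (hx₀ : 0 ≤ x) (hx : x < 1) (hy₀ : 0 ≤ y)
    (hy : y ≤ 1) (ht : ∀ a ∈ t, 0 ≤ a ∧ a ≤ δ) (hV : sqSum (x :: y :: t) = 3)
    (hq : exp (-(θ ^ 2 / 2 * (3 - m))) ≤ q) (hm : 0 < 1 - θ ^ 2 / 2 * (y ^ 2 - m))
    (h : q ≤ 1 / 4 * (1 - θ ^ 2 / 2 * (y ^ 2 - m)) * (1 - θ ^ 2 / 2 * (1 - y) ^ 2)) :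
    radExcess (x :: y :: t) 0 ≤ 1 / 4 := by
  have hπ := pi_gt_d6
  have hcos : 0 < cos (θ * (1 - y)) :=
    cos_pos_of_mem_Ioo ⟨by nlinarith, by nlinarith⟩
  simp only [sqSum_cons] at hV
  rw [radExcess_cons_zero, radExcess_perm (List.perm_append_singleton y t).symm]
  refine (radExcess_append_singleton_le hθ hδ (by linarith) t ht hy₀ hy
    (by rwa [abs_of_nonneg hx₀])).trans ((div_le_iff₀ hcos).2 ?_)
  calc _ ≤ exp (-(θ ^ 2 / 2 * x ^ 2)) * exp (-(θ ^ 2 / 2 * sqSum t)) := by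
        gcongr
        exact cos_mul_le_exp_neg hθ.le hx₀ (by nlinarith)
    _ = exp (-(θ ^ 2 / 2 * (3 - y ^ 2))) := by
        rw [← exp_add, ← hV]
        ring_nf
    _ ≤ _ := exp_neg_mul_le_mul_cos hy (by norm_num) hq hm h

open Real in
lemma radExcess_pair_cons_le_quarter (θ δ r W : ℝ) {p q b : ℝ} {t : List ℝ} (hθ : 0 < θ)
    (hδ : 0 < δ) (hθδ : θ * (1 + δ) ≤ 1.5707) (hpq : 1 ≤ p + q) (hpq' : |p - q| < 1)
    (hb₀ : 0 ≤ b) (hb : b ≤ 1) (hr : 1 - b ≤ r) (ht : ∀ a ∈ t, 0 ≤ a ∧ a ≤ δ)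
    (hW : W ≤ sqSum t + (p - q) ^ 2)
    (h : exp (-(θ ^ 2 / 2 * W)) ≤ 1 / 2 * (1 - θ ^ 2 / 2 * r ^ 2)) :
    radExcess (p :: q :: b :: t) 0 ≤ 1 / 4 := by
  have hπ := pi_gt_d6
  have hcos : 0 < cos (θ * (1 - b)) :=
    cos_pos_of_mem_Ioo ⟨by nlinarith, by nlinarith⟩
  have h₁ := radExcess_append_singleton_le hθ hδ (by linarith) t ht hb₀ hb hpq'
  suffices cos (θ * (p - q)) * exp (-(θ ^ 2 / 2 * sqSum t)) / cos (θ * (1 - b)) ≤ 1 / 2 by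
    have h₂ := radExcess_pair_le hpq (b :: t)
    rw [radExcess_perm (List.perm_append_singleton b t).symm] at h₂
    linarith
  rw [div_le_iff₀ hcos]
  calc _ ≤ exp (-(θ ^ 2 / 2 * |p - q| ^ 2)) * exp (-(θ ^ 2 / 2 * sqSum t)) := by
        rw [← cos_abs, abs_mul, abs_of_pos hθ]
        gcongr
        exact cos_mul_le_exp_neg hθ.le (abs_nonneg _) (by nlinarith)
    _ ≤ exp (-(θ ^ 2 / 2 * W)) := by
        rw [← exp_add, exp_le_exp, sq_abs]
        nlinarith [mul_le_mul_of_nonneg_left hW (sq_nonneg θ)]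
    _ ≤ _ := h.trans (by gcongr; exact one_sub_le_cos θ (by linarith) hr)

open Real in
lemma radExcess_le_quarter_of_le_fifth {x : ℝ} {t : List ℝ} (hx₀ : 0 ≤ x) (hx : x < 1)
    (ht : ∀ a ∈ t, 0 ≤ a ∧ a ≤ 0.2) (hV : sqSum (x :: t) = 3) :
    radExcess (x :: t) 0 ≤ 1 / 4 := by
  have hπ := pi_gt_d6
  rw [sqSum_cons] at hV
  obtain ⟨l₁, l₂, rfl, h₁, h₂⟩ := exists_append_sqSum t ht (w := 0.6) (by norm_num) (by nlinarith)
  rw [sqSum_append] at hV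
  have hcos : ∀ s : ℝ, |s| < 1.2 → 0 ≤ cos (1.3 * s) := by
    intro s hs
    rw [abs_lt] at hs
    exact cos_nonneg_of_neg_pi_div_two_le_of_le (by linarith) (by linarith)
  have hB : ∀ s, |s| < 1 → radExcess l₂ s ≤ 1.8 * cos (1.3 * s) := by
    intro s hs
    have hq := radExcess_append_le_quadratic (m := 0) (ρ := 1) (δ := 0.2) (B := []) (by norm_num)
      (by norm_num) (by norm_num) l₂ (fun a ha => ht a (by simp [ha]))
      (fun l' _ t h _ => radExcess_nonpos _ h) hs
    rw [List.append_nil] at hq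
    have hs2 : s ^ 2 ≤ 1 := (sq_lt_one_iff_abs_lt_one s).2 hs |>.le
    have hc : 2 * (1 - (1.3 * s) ^ 2 / 8) ^ 2 - 1 ≤ cos (1.3 * s) := by
      have := one_sub_sq_div_two_le_cos (x := 1.3 * s / 2)
      rw [show 1.3 * s = 2 * (1.3 * s / 2) by ring, cos_two_mul]
      nlinarith
    have hd : ((1 + 0.2) ^ 2 - s ^ 2) / (sqSum l₂ + (1 + 0.2) ^ 2 - 1 ^ 2) ≤
        ((1 + 0.2) ^ 2 - s ^ 2) / 1.04 := by
      apply div_le_div_of_nonneg_left <;> linarith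
    have he : ((1 + 0.2) ^ 2 - s ^ 2) / 1.04 ≤ 1.8 * (2 * (1 - (1.3 * s) ^ 2 / 8) ^ 2 - 1) := by
      rw [div_le_iff₀ (by norm_num)]
      nlinarith [sq_nonneg (1 - s ^ 2)]
    linarith
  rw [radExcess_cons_zero]
  refine (radExcess_append_le_cos_mul_exp (θ := 1.3) (c := 1.3 ^ 2 / 2) (δ := 0.2) (by norm_num)
    (by norm_num) (by norm_num) (by linarith) l₁ (fun a ha => ?_) hB (fun l' _ s h hs => ?_)
    (by rwa [abs_of_nonneg hx₀])).trans ?_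
  · obtain ⟨h₀, h₁⟩ := ht a (by simp [ha])
    exact ⟨h₀, h₁, cos_mul_le_exp_neg (by norm_num) h₀ (by linarith)⟩
  · refine (radExcess_nonpos _ h).trans ?_
    have := hcos s (by linarith)
    positivity
  · have he : exp (-(1.3 ^ 2 / 2 * 2.36)) ≤ 1 / 7.2 :=
      exp_neg_le_of_one_le_mul (by norm_num) (by norm_num)
    calc _ ≤ 1.8 * exp (-(1.3 ^ 2 / 2 * x ^ 2)) * exp (-(1.3 ^ 2 / 2 * sqSum l₁)) := by
          gcongr
          exact cos_mul_le_exp_neg (by norm_num) hx₀ (by linarith)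
      _ = 1.8 * exp (-(1.3 ^ 2 / 2 * (x ^ 2 + sqSum l₁))) := by
          rw [mul_assoc, ← exp_add]
          ring_nf
      _ ≤ 1.8 * exp (-(1.3 ^ 2 / 2 * 2.36)) := by
          gcongr
          linarith
      _ ≤ _ := by linarith

/-- The range in which the second weight is at most `0.6` and the others are at most `0.45`. -/
lemma radExcess_le_quarter_of_le {x y z : ℝ} {t : List ℝ} (hx : x < 1) (hyx : y ≤ x) (hz₀ : 0 ≤ z)
    (hzy : z ≤ y) (hz : z ≤ 0.45) (hy : y ≤ 0.6) (ht : ∀ a ∈ t, 0 ≤ a ∧ a ≤ z)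
    (hV : sqSum (x :: y :: t) = 3) : radExcess (x :: y :: t) 0 ≤ 1 / 4 := by
  rcases le_or_gt y 0.2 with h₁ | h₁
  · refine radExcess_le_quarter_of_le_fifth (by linarith) hx (fun a ha => ?_) hV
    rcases List.mem_cons.1 ha with rfl | ha
    · exact ⟨by linarith, h₁⟩
    · exact ⟨(ht a ha).1, by linarith [(ht a ha).2]⟩
  rcases le_or_gt y 0.35 with h₂ | h₂
  · refine radExcess_cons_cons_le_quarter 1.16 0.35 0.04 0.1375 (by norm_num) (by norm_num)
      (by norm_num) (by linarith) hx (by linarith) (by linarith)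
      (fun a ha => ⟨(ht a ha).1, by linarith [(ht a ha).2]⟩) hV
      (exp_neg_le_of_one_le_mul (by norm_num) (by norm_num)) (by nlinarith) ?_
    nlinarith [mul_nonneg (sub_nonneg.2 h₁.le) (sub_nonneg.2 h₂)]
  · refine radExcess_cons_cons_le_quarter 1.08 0.45 0.16 0.1915 (by norm_num) (by norm_num)
      (by norm_num) (by linarith) hx (by linarith) (by linarith)
      (fun a ha => ⟨(ht a ha).1, by linarith [(ht a ha).2]⟩) hV
      (exp_neg_le_of_one_le_mul (by norm_num) (by norm_num)) (by nlinarith) ?_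
    nlinarith [mul_nonneg (sub_nonneg.2 h₂.le) (sub_nonneg.2 hy)]

open Real in
lemma cos_mul_le_exp_neg_of_mem_Icc {a : ℝ} (h₀ : 0.45 ≤ a) (h₁ : a ≤ 1) :
    cos (1.047 * a) ≤ exp (-(0.566 * a ^ 2)) := by
  have h₂ : a ^ 2 ≤ 1 := by nlinarith
  have h₃ : 0.2025 ≤ a ^ 2 := by nlinarith
  have hc := cos_le_one_sub_add (x := 1.047 * a) (by linarith) (by linarith)
  have he := (abs_le.1 (exp_bound (x := -(0.566 * a ^ 2)) (by
    rw [abs_neg, abs_of_nonneg (by positivity)]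
    linarith) (n := 4) (by norm_num))).1
  rw [abs_neg, abs_of_nonneg (by positivity)] at he
  simp only [Finset.sum_range_succ, Finset.sum_range_zero, Nat.factorial] at he
  norm_num at he
  have h4 : (1.047 * a) ^ 4 = 1.047 ^ 4 * (a ^ 2) ^ 2 := by ring
  have h2 : (1.047 * a) ^ 2 = 1.047 ^ 2 * a ^ 2 := by ring
  rw [h4, h2] at hc
  generalize a ^ 2 = z at *
  refine hc.trans ?_
  have : 0 ≤ z * (-0.0178955 + 0.110108 * z - 0.03023 * z ^ 2 - 0.00535 * z ^ 3) := by
    refine mul_nonneg (by linarith) ?_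
    nlinarith [mul_nonneg (sub_nonneg.2 h₃) (sub_nonneg.2 h₂),
      mul_nonneg (mul_nonneg (sub_nonneg.2 h₃) (sub_nonneg.2 h₂)) (sub_nonneg.2 h₂)]
  nlinarith [pow_nonneg (h₃.trans' (by norm_num : (0 : ℝ) ≤ 0.2025)) 3]

open Real in
/-- The weights above and below `0.45` are treated with different frequencies. -/
lemma radExcess_le_quarter_of_two_phases {x y : ℝ} {t : List ℝ} (hx : x < 1) (hyx : y ≤ x)
    (hy₀ : 0.45 < y) (hy : y ≤ 0.6) (ht : ∀ a ∈ t, 0 ≤ a ∧ a ≤ 0.5)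
    (hV : sqSum (x :: y :: t) = 3) : radExcess (x :: y :: t) 0 ≤ 1 / 4 := by
  have hπ := pi_gt_d6
  set l₁ := t.filter fun a => decide (0.45 < a) with hl₁
  set l₂ := t.filter fun a => !decide (0.45 < a) with hl₂
  have hp : (l₁ ++ l₂).Perm t := List.filter_append_perm _ t
  have hmem₁ : ∀ a ∈ l₁, 0.45 ≤ a ∧ a ≤ 0.5 := by
    intro a ha
    rw [hl₁, List.mem_filter, decide_eq_true_iff] at ha
    exact ⟨ha.2.le, (ht a ha.1).2⟩
  have hmem₂ : ∀ a ∈ l₂, 0 ≤ a ∧ a ≤ 0.45 := by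
    intro a ha
    rw [hl₂, List.mem_filter, Bool.not_eq_true', decide_eq_false_iff_not, not_lt] at ha
    exact ⟨(ht a ha.1).1, ha.2⟩
  simp only [sqSum_cons, ← sqSum_perm hp, sqSum_append] at hV
  have hcos : 0 < cos (1.07 * (1 - y)) :=
    cos_pos_of_mem_Ioo ⟨by linarith, by linarith⟩
  set C := exp (-(0.566 * sqSum l₂)) / cos (1.07 * (1 - y)) with hC
  have hC₀ : 0 < C := by positivity
  have hB : ∀ s, |s| < 1 → radExcess (l₂ ++ [y]) s ≤ C * cos (1.047 * s) := by
    intro s hs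
    refine (radExcess_append_singleton_le (θ := 1.07) (δ := 0.45) (by norm_num) (by norm_num)
      (by linarith) l₂ hmem₂ (by linarith) (by linarith) hs).trans ?_
    rw [hC, div_mul_eq_mul_div (exp _), mul_comm (cos (1.07 * s))]
    have h₁ : cos (1.07 * s) ≤ cos (1.047 * s) := by
      rw [← cos_abs, ← cos_abs (1.047 * s), abs_mul, abs_mul]
      refine cos_le_cos_of_nonneg_of_le_pi (by positivity) ?_ ?_
      · rw [abs_of_pos (by norm_num)]
        linarith
      · gcongr
        norm_num [abs_of_pos]
    have h₂ : 0 ≤ cos (1.07 * s) := by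
      rw [abs_lt] at hs
      exact cos_nonneg_of_neg_pi_div_two_le_of_le (by linarith) (by linarith)
    have h₃ : 0.566 * sqSum l₂ ≤ 1.07 ^ 2 / 2 * sqSum l₂ :=
      mul_le_mul_of_nonneg_right (by norm_num) (sqSum_nonneg _)
    gcongr
  have hcosx := cos_mul_le_exp_neg_of_mem_Icc (a := x) (by linarith) hx.le
  have h := radExcess_append_le_cos_mul_exp (θ := 1.047) (c := 0.566) (ρ := 1) (δ := 0.5)
    (B := l₂ ++ [y]) (by norm_num) hC₀.le (by norm_num) (by linarith) l₁ (fun a ha => by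
      obtain ⟨h₀, h₁⟩ := hmem₁ a ha
      exact ⟨by linarith, h₁, cos_mul_le_exp_neg_of_mem_Icc h₀ (by linarith)⟩) hB
    (fun l' _ s h hs => by
      refine (radExcess_nonpos _ h).trans ?_
      rw [abs_lt] at hs
      have := cos_nonneg_of_neg_pi_div_two_le_of_le (x := 1.047 * s) (by linarith) (by linarith)
      positivity) (s := x) (by rwa [abs_of_nonneg (by linarith)])
  have hperm : (y :: t).Perm (l₁ ++ (l₂ ++ [y])) := by
    rw [← List.append_assoc]
    exact (hp.symm.cons y).trans (List.perm_append_singleton y _).symm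
  rw [radExcess_cons_zero, radExcess_perm hperm]
  refine h.trans ?_
  rw [hC, div_mul_eq_mul_div, div_mul_eq_mul_div, div_le_iff₀ hcos]
  calc _ ≤ exp (-(0.566 * sqSum l₂)) * exp (-(0.566 * x ^ 2)) * exp (-(0.566 * sqSum l₁)) := by
        gcongr
    _ = exp (-(0.566 * (3 - y ^ 2))) := by
        rw [← exp_add, ← exp_add, ← hV]
        ring_nf
    _ ≤ _ := by
        refine exp_neg_mul_le_mul_cos (m := 0.25) (q := 0.2112) (by linarith) (by norm_num)
          (exp_neg_le_of_one_le_mul (by norm_num) (by norm_num)) (by nlinarith) ?_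
        nlinarith [mul_nonneg (sub_nonneg.2 hy₀.le) (sub_nonneg.2 hy)]

open Real in
/-- The range in which the third weight is at most `1 / 2` and the second one exceeds `0.6`. -/
lemma radExcess_le_quarter_of_gt {x y z : ℝ} {t : List ℝ} (hx : x < 1) (hyx : y ≤ x) (hz₀ : 0 ≤ z)
    (hz : z ≤ 0.5) (hy : 0.6 < y) (ht : ∀ a ∈ t, 0 ≤ a ∧ a ≤ z)
    (hV : sqSum (x :: y :: z :: t) = 3) : radExcess (x :: y :: z :: t) 0 ≤ 1 / 4 := by
  have hzt : ∀ a ∈ z :: t, 0 ≤ a ∧ a ≤ z := by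
    intro a ha
    rcases List.mem_cons.1 ha with rfl | ha
    exacts [⟨hz₀, le_rfl⟩, ht a ha]
  rcases le_or_gt 1 (x + z) with h₁ | h₁
  · rw [radExcess_perm ((List.Perm.swap z y t).cons x)]
    rcases le_or_gt 1 (x + y - z) with h₂ | h₂
    · exact radExcess_triple_le h₁ (by linarith [le_abs_self (x - z)]) t
    · simp only [sqSum_cons] at hV
      exact radExcess_pair_cons_le_quarter 1.047 0.5 0.4 1.5 (by norm_num) (by norm_num)
        (by norm_num) h₁ (abs_lt.2 ⟨by linarith, by linarith⟩) (by linarith) (by linarith)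
        (by linarith) (fun a ha => ⟨(ht a ha).1, by linarith [(ht a ha).2]⟩) (by nlinarith)
        (exp_neg_le_of_one_le_mul (by norm_num) (by norm_num))
  rcases le_or_gt y 0.8 with h₂ | h₂
  · refine radExcess_cons_cons_le_quarter 1.12 0.4 0.36 0.192 (by norm_num) (by norm_num)
      (by norm_num) (by linarith) hx (by linarith) (by linarith)
      (fun a ha => ⟨(hzt a ha).1, by linarith [(hzt a ha).2]⟩) hV
      (exp_neg_le_of_one_le_mul (by norm_num) (by norm_num)) (by nlinarith) ?_
    nlinarith [mul_nonneg (sub_nonneg.2 hy.le) (sub_nonneg.2 h₂)]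
  · refine radExcess_cons_cons_le_quarter 1.3 0.2 1 0.19 (by norm_num) (by norm_num)
      (by norm_num) (by linarith) hx (by linarith) (by linarith)
      (fun a ha => ⟨(hzt a ha).1, by linarith [(hzt a ha).2]⟩) hV
      (exp_neg_le_of_one_le_mul (by norm_num) (by norm_num)) (by nlinarith) ?_
    nlinarith [mul_nonneg (sub_nonneg.2 h₂.le) (sub_nonneg.2 (hyx.trans hx.le))]

lemma radExcess_le_quarter_of_third_le_half {x y z : ℝ} {t : List ℝ} (hx : x < 1) (hyx : y ≤ x)
    (hzy : z ≤ y) (hz₀ : 0 ≤ z) (hz : z ≤ 0.5) (ht : ∀ a ∈ t, 0 ≤ a ∧ a ≤ z)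
    (hV : sqSum (x :: y :: z :: t) = 3) : radExcess (x :: y :: z :: t) 0 ≤ 1 / 4 := by
  have hzt : ∀ a ∈ z :: t, 0 ≤ a ∧ a ≤ z := by
    intro a ha
    rcases List.mem_cons.1 ha with rfl | ha
    exacts [⟨hz₀, le_rfl⟩, ht a ha]
  rcases lt_or_ge 0.6 y with hy | hy
  · exact radExcess_le_quarter_of_gt hx hyx hz₀ hz hy ht hV
  rcases le_or_gt z 0.45 with h | h
  · exact radExcess_le_quarter_of_le hx hyx hz₀ hzy h hy hzt hV
  · exact radExcess_le_quarter_of_two_phases hx hyx (by linarith) hy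
      (fun a ha => ⟨(hzt a ha).1, by linarith [(hzt a ha).2]⟩) hV

lemma radExcess_le_quarter_of_one_le_add {x y z w : ℝ} {t : List ℝ} (hyx : y ≤ x)
    (hzy : z ≤ y) (hwz : w ≤ z) (h : 1 ≤ z + w) :
    radExcess (x :: y :: z :: w :: t) 0 ≤ 1 / 4 := by
  have hp : (x :: y :: z :: w :: t).Perm (z :: w :: y :: x :: t) :=
    (List.perm_append_comm (l₁ := [x, y]) (l₂ := [z, w])).append_right t |>.trans
      (((List.Perm.swap y x t).cons w).cons z)
  rw [radExcess_perm hp]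
  have h₁ := radExcess_pair_le h (y :: x :: t)
  rw [radExcess_cons y] at h₁
  linarith [radExcess_cons_le_half (x := x) (u := z - w + y)
      (by linarith [le_abs_self (z - w + y)]) t,
    radExcess_cons_le_half (x := x) (u := z - w - y)
      (by linarith [neg_le_abs (z - w - y)]) t]

open Real in
/-- The range in which the first and the fourth weight add up to at least one. -/
lemma radExcess_le_quarter_of_one_le_first_add_fourth {x y z w : ℝ} {t : List ℝ} (hx : x < 1)
    (hyx : y ≤ x) (hzy : z ≤ y) (hz : 0.5 < z) (hzw : z + w < 1) (hxw : 1 ≤ x + w)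
    (ht : ∀ a ∈ w :: t, 0 ≤ a ∧ a ≤ w) (hV : sqSum (x :: y :: z :: w :: t) = 3) :
    radExcess (x :: y :: z :: w :: t) 0 ≤ 1 / 4 := by
  rcases le_or_gt 1 (x + y - w) with h₁ | h₁
  · have hp : (x :: y :: z :: w :: t).Perm (x :: w :: y :: z :: t) :=
      ((List.perm_append_comm (l₁ := [y, z]) (l₂ := [w])).append_right t).cons x
    rw [radExcess_perm hp]
    exact radExcess_triple_le hxw (by linarith [le_abs_self (x - w)]) _
  · have hp : (x :: y :: z :: w :: t).Perm (y :: z :: x :: w :: t) :=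
      (List.perm_append_comm (l₁ := [x]) (l₂ := [y, z])).append_right (w :: t)
    rw [radExcess_perm hp]
    simp only [sqSum_cons x, sqSum_cons y, sqSum_cons z] at hV
    rcases le_or_gt 0.6 x with h₂ | h₂
    · refine radExcess_pair_cons_le_quarter 1.047 0.5 0.4 1.5 (by norm_num) (by norm_num)
        (by norm_num) (by linarith) (abs_lt.2 ⟨by linarith, by linarith⟩) (by linarith) hx.le
        (by linarith) (fun a ha => ⟨(ht a ha).1, by linarith [(ht a ha).2]⟩) ?_
        (exp_neg_le_of_one_le_mul (by norm_num) (by norm_num))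
      nlinarith [mul_nonneg (sub_nonneg.2 hz.le) (sub_nonneg.2 (hz.le.trans hzy)),
        mul_nonneg (sub_nonneg.2 hz.le) (sub_nonneg.2 (hz.le.trans (hzy.trans hyx))),
        mul_nonneg (sub_nonneg.2 (hz.le.trans hzy)) (sub_nonneg.2 (hz.le.trans (hzy.trans hyx)))]
    · refine radExcess_pair_cons_le_quarter 1.047 0.5 0.5 1.92 (by norm_num) (by norm_num)
        (by norm_num) (by linarith) (abs_lt.2 ⟨by linarith, by linarith⟩) (by linarith) hx.le
        (by linarith) (fun a ha => ⟨(ht a ha).1, by linarith [(ht a ha).2]⟩) ?_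
        (exp_neg_le_of_one_le_mul (by norm_num) (by norm_num))
      nlinarith

lemma radExcess_cons_le_three_quarters {r x : ℝ} {l : List ℝ} (hr : 0 < r) (hx : x ≤ 1)
    (hl : ∀ a ∈ l, 0 ≤ a ∧ a ≤ r) (hV : 2 * (1 - x + r) ^ 2 ≤ sqSum l) (u : ℝ) :
    radExcess (x :: l) u ≤ 3 / 4 := by
  rcases le_or_gt (1 - x) |u| with h | h
  · linarith [radExcess_cons_le_half (x := x) (u := u) (by linarith) l]
  rw [radExcess_perm (List.perm_append_singleton x l).symm]
  refine (radExcess_append_le_quadratic (m := 1 / 2) (by norm_num) (by linarith) hr l hl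
    (fun l' _ t h₁ _ => ?_) h).trans ?_
  · rw [radExcess_perm (List.perm_append_singleton x l')]
    exact radExcess_cons_le_half (by linarith) l'
  · have hsq : (1 - x) ^ 2 < (1 - x + r) ^ 2 :=
      pow_lt_pow_left₀ (by linarith) (by linarith) two_ne_zero
    have : ((1 - x + r) ^ 2 - u ^ 2) / (sqSum l + (1 - x + r) ^ 2 - (1 - x) ^ 2) ≤ 1 / 2 := by
      rw [div_le_iff₀ (by linarith [sqSum_nonneg l])]
      linarith [sq_nonneg u]
    linarith

lemma radExcess_cons_cons_le {x y s : ℝ} (h₁ : 1 ≤ x + |s|) (h₂ : 1 ≤ x + y - |s|)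
    (l : List ℝ) : radExcess (x :: y :: l) s ≤ radExcess l (x - |s| - y) / 4 := by
  rw [← radExcess_abs, radExcess_cons, ← radExcess_neg _ (|s| - x), neg_sub,
    radExcess_cons y _ (x - |s|)]
  have h₃ := radExcess_nonpos (y :: l) (s := |s| + x) (by linarith [le_abs_self (|s| + x)])
  have h₄ := radExcess_nonpos l (s := x - |s| + y) (by linarith [le_abs_self (x - |s| + y)])
  linarith

open Real in
/-- The range in which the three largest weights are close to one. -/
lemma radExcess_le_quarter_of_sqSum_lt_one {x y z : ℝ} {l : List ℝ} (hx : x < 1)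
    (hyx : y ≤ x) (hzy : z ≤ y) (hz : 0.5 < z) (hxyz : x + y - z < 1)
    (hl : ∀ a ∈ l, 0 ≤ a ∧ a ≤ 1 - x) (hV : sqSum (x :: y :: z :: l) = 3) (hV₁ : sqSum l < 1) :
    radExcess (x :: y :: z :: l) 0 ≤ 1 / 4 := by
  obtain ⟨r, hr⟩ : ∃ r, r = 1 - x := ⟨_, rfl⟩
  rw [← hr] at hl
  have hr₀ : 0 < r := by linarith
  have hVr : 1.5 * (r + (1 - y) + (1 - z)) ≤ sqSum l := by
    simp only [sqSum_cons] at hV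
    nlinarith
  clear hV
  have hV45 : 4.5 * r ≤ sqSum l := by linarith
  have hsq : 2 * (1 - z + r) ^ 2 ≤ sqSum l / 2 := by
    have := mul_le_mul_of_nonneg_left (show 1 - z + r ≤ 1 / 2 by linarith)
      (show 0 ≤ 1 - z + r by linarith)
    linarith
  obtain ⟨θ, hθ₀, hθr⟩ : ∃ θ : ℝ, 0 < θ ∧ θ * r = 0.3 :=
    ⟨0.3 / r, by positivity, div_mul_cancel₀ _ hr₀.ne'⟩
  have hθr₂ : θ ^ 2 / 2 * r ^ 2 = 0.045 := by linear_combination (θ * r + 0.3) / 2 * hθr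
  have hc₀ : 0 ≤ θ ^ 2 / 2 := by positivity
  have hcV : 0.9112 ≤ θ ^ 2 / 2 * sqSum l := by
    have h₁ : 1.35 ≤ θ := by
      by_contra! h
      linarith [mul_lt_mul'' h (show r < 2 / 9 by linarith) hθ₀.le hr₀.le]
    have h₂ := mul_le_mul_of_nonneg_left hV45 hc₀
    have h₃ : θ ^ 2 / 2 * (4.5 * r) = 0.675 * θ := by linear_combination 2.25 * θ * hθr
    linarith
  have hcos : ∀ s k, |s| ≤ k * r → 1 - 0.045 * k ^ 2 ≤ cos (θ * s) := by
    intro s k hs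
    rw [← cos_abs, abs_mul, abs_of_pos hθ₀, ← hθr₂, mul_assoc, ← mul_pow, mul_comm r]
    exact one_sub_le_cos θ (abs_nonneg s) hs
  have hθπ : θ * (r + r) ≤ π / 2 := by linarith [pi_gt_d2]
  have hp : (x :: y :: z :: l).Perm (l ++ [x, y, z]) :=
    List.perm_append_comm (l₁ := [x, y, z])
  rw [radExcess_perm hp]
  refine (radExcess_append_le_cos_mul_exp (c := θ ^ 2 / 2)
    (C := 1 / 4 * exp (θ ^ 2 / 2 * sqSum l)) hθ₀.le
    (by positivity) hr₀.le hθπ l (fun a ha => ?_) (fun s hs => ?_) (fun l' hl' t h₁ h₂ => ?_)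
    (s := 0) (by rwa [abs_zero])).trans_eq ?_
  · obtain ⟨h₁, h₂⟩ := hl a ha
    exact ⟨h₁, h₂, cos_mul_le_exp_neg hθ₀.le h₁
      ((mul_le_mul_of_nonneg_left (by linarith) hθ₀.le).trans hθπ)⟩
  · have hc₁ := hcos s 1 (by linarith)
    have he : 1.4556 ≤ exp (θ ^ 2 / 2 * sqSum l / 2) := by
      linarith [add_one_le_exp (θ ^ 2 / 2 * sqSum l / 2)]
    have he₂ := mul_le_mul he he (by norm_num) (by positivity)
    rw [← exp_add, add_halves] at he₂
    rw [abs_lt] at hs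
    rw [radExcess_cons]
    have h₁ := radExcess_cons_le_half (x := y) (u := s + x)
      (by linarith [le_abs_self (s + x)]) [z]
    have h₂ := radExcess_cons_le_half (x := y) (u := s - x)
      (by linarith [neg_le_abs (s - x)]) [z]
    linarith [mul_le_mul he₂ hc₁ (by norm_num) (by positivity)]
  · have hc₂ := hcos t 2 (by linarith)
    rw [radExcess_perm (List.perm_append_comm (l₂ := [x, y, z]))]
    refine (radExcess_cons_cons_le (by linarith) (by linarith) (z :: l')).trans ?_
    suffices radExcess (z :: l') (x - |t| - y) ≤
        cos (θ * t) * exp (θ ^ 2 / 2 * (sqSum l - sqSum l')) by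
      rw [mul_sub, sub_eq_add_neg (θ ^ 2 / 2 * sqSum l), exp_add] at this
      linarith
    have he := add_one_le_exp (θ ^ 2 / 2 * (sqSum l - sqSum l'))
    rcases le_or_gt (sqSum l / 2) (sqSum l') with h | h
    · have hsub : sqSum l' ≤ sqSum l := by
        obtain ⟨m, rfl⟩ := hl'
        rw [sqSum_append]
        linarith [sqSum_nonneg m]
      have h₃ := radExcess_cons_le_three_quarters hr₀ (by linarith)
        (fun a ha => hl a (hl'.subset ha)) (hsq.trans h) (x - |t| - y)
      have h₄ := mul_nonneg hc₀ (sub_nonneg.2 hsub)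
      linarith [mul_le_mul hc₂ (show 1 ≤ exp (θ ^ 2 / 2 * (sqSum l - sqSum l')) by linarith)
        (by norm_num) (by linarith)]
    · have h₃ := radExcess_le_one (z :: l') (x - |t| - y)
      have h₄ := mul_le_mul_of_nonneg_left
        (show sqSum l / 2 ≤ sqSum l - sqSum l' by linarith) hc₀
      linarith [mul_le_mul hc₂ (show 1.4556 ≤ exp (θ ^ 2 / 2 * (sqSum l - sqSum l')) by linarith)
        (by norm_num) (by linarith)]
  · rw [mul_zero, cos_zero, mul_one, mul_assoc, ← exp_add, add_neg_cancel, exp_zero, mul_one]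

open Real in
/-- The range in which the first and the fourth weight add up to less than one. -/
lemma radExcess_le_quarter_of_first_add_fourth_lt_one {x y z w : ℝ} {t : List ℝ} (hx : x < 1)
    (hyx : y ≤ x) (hzy : z ≤ y) (hz : 0.5 < z) (hxyz : x + y - z < 1) (hxw : x + w < 1)
    (ht : ∀ a ∈ w :: t, 0 ≤ a ∧ a ≤ w) (hV : sqSum (x :: y :: z :: w :: t) = 3) :
    radExcess (x :: y :: z :: w :: t) 0 ≤ 1 / 4 := by
  have hp : (x :: y :: z :: w :: t).Perm (y :: z :: x :: w :: t) :=
    (List.perm_append_comm (l₁ := [x]) (l₂ := [y, z])).append_right (w :: t)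
  have habs : |y - z| < 1 := abs_lt.2 ⟨by linarith, by linarith⟩
  have hW : 3 * (1 - x ^ 2) ≤ sqSum (w :: t) := by
    rw [sqSum_cons, sqSum_cons, sqSum_cons] at hV
    nlinarith
  rcases lt_or_ge x 0.67 with h₁ | h₁
  · rw [radExcess_perm hp]
    exact radExcess_pair_cons_le_quarter 1.047 0.5 0.5 1.653 (by norm_num) (by norm_num)
      (by norm_num) (by linarith) habs (by linarith) hx.le (by linarith)
      (fun a ha => ⟨(ht a ha).1, by linarith [(ht a ha).2]⟩) (by nlinarith)
      (exp_neg_le_of_one_le_mul (by norm_num) (by norm_num))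
  rcases lt_or_ge x 0.75 with h₂ | h₂
  · rw [radExcess_perm hp]
    exact radExcess_pair_cons_le_quarter 1.18 0.33 0.33 1.3125 (by norm_num) (by norm_num)
      (by norm_num) (by linarith) habs (by linarith) hx.le (by linarith)
      (fun a ha => ⟨(ht a ha).1, by linarith [(ht a ha).2]⟩) (by nlinarith)
      (exp_neg_le_of_one_le_mul (by norm_num) (by norm_num))
  rcases le_or_gt 1 (sqSum (w :: t)) with h₃ | h₃
  · rw [radExcess_perm hp]
    exact radExcess_pair_cons_le_quarter 1.25 0.25 0.25 1 (by norm_num) (by norm_num)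
      (by norm_num) (by linarith) habs (by linarith) hx.le (by linarith)
      (fun a ha => ⟨(ht a ha).1, by linarith [(ht a ha).2]⟩) (by linarith [sq_nonneg (y - z)])
      (exp_neg_le_of_one_le_mul (by norm_num) (by norm_num))
  · exact radExcess_le_quarter_of_sqSum_lt_one hx hyx hzy hz hxyz
      (fun a ha => ⟨(ht a ha).1, by linarith [(ht a ha).2]⟩) hV h₃

theorem radExcess_le_quarter (l : List ℝ) (hl : l.Pairwise (· ≥ ·)) (h₀ : ∀ a ∈ l, 0 ≤ a)
    (hV : sqSum l = 3) : radExcess l 0 ≤ 1 / 4 := by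
  match l with
  | [] => norm_num at hV
  | x :: l =>
  rcases le_or_gt 1 x with hx | hx
  · rw [radExcess_cons_zero]
    linarith [radExcess_nonpos l (hx.trans (le_abs_self x))]
  have hx₀ := h₀ x (by simp)
  match l with
  | [] =>
    simp at hV
    nlinarith
  | [y] =>
    simp at hl h₀ hV
    nlinarith
  | [y, z] =>
    simp at hl h₀ hV
    nlinarith
  | y :: z :: w :: t =>
    simp only [List.pairwise_cons, List.mem_cons, forall_eq_or_imp, ge_iff_le] at hl h₀
    obtain ⟨⟨hyx, -⟩, ⟨hzy, -⟩, ⟨hwz, htz⟩, htw, -⟩ := hl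
    obtain ⟨-, -, hz₀, hw₀, ht₀⟩ := h₀
    have hwt : ∀ a ∈ w :: t, 0 ≤ a ∧ a ≤ w := by
      intro a ha
      rcases List.mem_cons.1 ha with rfl | ha
      exacts [⟨hw₀, le_rfl⟩, ⟨ht₀ a ha, htw a ha⟩]
    rcases le_or_gt z 0.5 with hz | hz
    · exact radExcess_le_quarter_of_third_le_half hx hyx hzy hz₀ hz
        (fun a ha => ⟨(hwt a ha).1, (hwt a ha).2.trans hwz⟩) hV
    rcases le_or_gt 1 (z + w) with h₁ | h₁
    · exact radExcess_le_quarter_of_one_le_add hyx hzy hwz h₁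
    rcases le_or_gt 1 (x + y - z) with h₂ | h₂
    · rw [radExcess_perm ((List.Perm.swap z y _).cons x)]
      exact radExcess_triple_le (by linarith) (by linarith [le_abs_self (x - z)]) _
    rcases le_or_gt 1 (x + w) with h₃ | h₃
    · exact radExcess_le_quarter_of_one_le_first_add_fourth hx hyx hzy hz h₁ h₃ hwt hV
    · exact radExcess_le_quarter_of_first_add_fourth_lt_one hx hyx hzy hz h₂ h₃ hwt hV

theorem abs_rademacher_ge_inv_sqrt3 (n : ℕ) (hn : 0 < n) (a : Fin n → ℝ)
    (hnorm : ∑ i, (a i) ^ 2 = 1) :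
    radProb a (fun x => |x| ≥ 1 / Real.sqrt 3) ≥ 3 / 8 :=
  three_eighths_le_radProb radExcess_le_quarter n a hnorm
end
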